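/- arXiv:2402.13342 — 5 statements merged into one kernel-verified Lean document; each statement's English description precedes it below -/
import Mathlib

section
/- Any two tilings f and g of Δ with the same hole set S are connected by a finite sequence of tilings with hole set S in which each tiling is obtained from the previous one either by a GD flip or by the inverse of a GD flip. -/
/-- The upward unit triangles of the side-`n` triangle Δ: pairs `(i,j)` with `i+j ≤ n-1`. -/
def UpTri (n : ℕ) : Set (ℕ × ℕ) := {p | p.1 + p.2 + 1 ≤ n}

/-- The downward unit triangles of Δ: pairs `(i,j)` with `i+j ≤ n-2`. -/
def DownTri (n : ℕ) : Set (ℕ × ℕ) := {p | p.1 + p.2 + 2 ≤ n}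

/-- The downward unit triangle `d` is adjacent to exactly the upward unit triangles
`d`, `(d.1+1, d.2)` and `(d.1, d.2+1)`. -/
def Adj (d u : ℕ × ℕ) : Prop :=
  u = d ∨ u = (d.1 + 1, d.2) ∨ u = (d.1, d.2 + 1)

/-- A fine mixed subdivision (tiling) of Δ with hole set `S`: a bijection `f` from the
downward unit triangles onto the upward unit triangles not in `S`, with `f d` adjacent
to `d` for every `d`. -/
def IsTiling (n : ℕ) (S : Set (ℕ × ℕ)) (f : ℕ × ℕ → ℕ × ℕ) : Prop :=
  Set.BijOn f (DownTri n) (UpTri n \ S) ∧ ∀ d ∈ DownTri n, Adj d (f d)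

/-- The upward unit triangles of the upward subtriangle `T(a,b,k)`. -/
def UpCells (a b k : ℕ) : Set (ℕ × ℕ) :=
  {p | a ≤ p.1 ∧ b ≤ p.2 ∧ p.1 + p.2 + 1 ≤ a + b + k}

/-- The downward unit triangles of the upward subtriangle `T(a,b,k)`. -/
def DownCells (a b k : ℕ) : Set (ℕ × ℕ) :=
  {p | a ≤ p.1 ∧ b ≤ p.2 ∧ p.1 + p.2 + 2 ≤ a + b + k}

/-- `S` is spread-out: every upward subtriangle of size `k` contains at most `k` holes. -/
def SpreadOut (n : ℕ) (S : Finset (ℕ × ℕ)) : Prop :=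
  ∀ a b k : ℕ, a + b + k ≤ n →
    (S.filter (fun p => a ≤ p.1 ∧ b ≤ p.2 ∧ p.1 + p.2 + 1 ≤ a + b + k)).card ≤ k

/-- The upward unit triangles of the GD ring `R(a,b,m)`: upward cells of `T(a,b,m)` other
than the three corners and the cells of the central subtriangle `T(a+1,b+1,m-3)`. -/
def RingUp (a b m : ℕ) : Set (ℕ × ℕ) :=
  UpCells a b m \ ({(a, b), (a + m - 1, b), (a, b + m - 1)} ∪ UpCells (a + 1) (b + 1) (m - 3))

/-- The downward unit triangles of the GD ring `R(a,b,m)`. -/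
def RingDown (a b m : ℕ) : Set (ℕ × ℕ) :=
  DownCells a b m \ DownCells (a + 1) (b + 1) (m - 3)

/-- `f` contains a clockwise GD at `(a,b,m)`. -/
def CWGD (f : ℕ × ℕ → ℕ × ℕ) (a b m : ℕ) : Prop :=
  f '' RingDown a b m = RingUp a b m ∧ f (a, b) = (a, b + 1)

/-- `f` contains a counterclockwise GD at `(a,b,m)`. -/
def CCWGD (f : ℕ × ℕ → ℕ × ℕ) (a b m : ℕ) : Prop :=
  f '' RingDown a b m = RingUp a b m ∧ f (a, b) = (a + 1, b)

/-- `g` is obtained from `f` by a GD flip at `(a,b,m)`. -/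
def GDFlipAt (n : ℕ) (f g : ℕ × ℕ → ℕ × ℕ) (a b m : ℕ) : Prop :=
  3 ≤ m ∧ a + b + m ≤ n ∧ CWGD f a b m ∧ CCWGD g a b m ∧
    (∃ S : Set (ℕ × ℕ), IsTiling n S f ∧ IsTiling n S g) ∧
    ∀ d ∈ DownTri n, d ∉ RingDown a b m → g d = f d

/-- `g` is obtained from `f` by a GD flip (at some position). -/
def GDFlip (n : ℕ) (f g : ℕ × ℕ → ℕ × ℕ) : Prop :=
  ∃ a b m, GDFlipAt n f g a b m

/-- `K` is closed under the non-`f` oriented lattice edges. -/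
def Closed3 (P1 P2 P3 : ℤ → ℤ → Prop) (K : Set (ℤ × ℤ)) : Prop :=
  ∀ x y, (x, y) ∈ K → (P1 x y ∨ (x + 1, y) ∈ K) ∧ (P2 x y ∨ (x - 1, y + 1) ∈ K) ∧
    (P3 x y ∨ (x, y - 1) ∈ K)

structure Cfg (P1 P2 P3 : ℤ → ℤ → Prop) (K : Set (ℤ × ℤ)) (a b c : ℤ) : Prop where
  sub : ∀ x y, (x, y) ∈ K → a ≤ x ∧ b ≤ y ∧ x + y ≤ c
  left : ∃ y, (a, y) ∈ K
  bot : ∃ x, (x, b) ∈ K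
  right : ∃ x, (x, c - x) ∈ K
  closed : Closed3 P1 P2 P3 K
  min : ∀ K' ⊆ K, K'.Nonempty → Closed3 P1 P2 P3 K' → K' = K
  u12 : ∀ x y, a ≤ x → b ≤ y → x + y + 1 ≤ c → P1 x y → ¬ P2 (x + 1) y
  u13 : ∀ x y, a ≤ x → b ≤ y → x + y + 1 ≤ c → P1 x y → ¬ P3 x (y + 1)
  u23 : ∀ x y, a ≤ x → b ≤ y → x + y + 1 ≤ c → P2 (x + 1) y → ¬ P3 x (y + 1)
  dn : ∀ x y, a ≤ x → b ≤ y → x + y + 2 ≤ c →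
    P1 x (y + 1) ∨ P2 (x + 1) y ∨ P3 (x + 1) (y + 1)

theorem Cfg.rot {P1 P2 P3 : ℤ → ℤ → Prop} {K : Set (ℤ × ℤ)} {a b c : ℤ}
    (h : Cfg P1 P2 P3 K a b c) :
    Cfg (fun x y => P3 y (-x - y)) (fun x y => P1 y (-x - y)) (fun x y => P2 y (-x - y))
      {p | (p.2, -p.1 - p.2) ∈ K} (-c) a (-b) where
  sub := by
    intro x y hxy
    have := h.sub _ _ hxy
    simp only at this
    omega
  left := by
    obtain ⟨x, hx⟩ := h.right
    refine ⟨x, ?_⟩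
    show (x, - -c - x) ∈ K
    simpa using hx
  bot := by
    obtain ⟨y, hy⟩ := h.left
    refine ⟨-y - a, ?_⟩
    show (a, -(-y - a) - a) ∈ K
    simpa using hy
  right := by
    obtain ⟨x, hx⟩ := h.bot
    refine ⟨-b - x, ?_⟩
    show (-b - (-b - x), -(-b - x) - (-b - (-b - x))) ∈ K
    convert hx using 2 <;> ring
  closed := by
    intro x y hxy
    obtain ⟨h1, h2, h3⟩ := h.closed y (-x - y) hxy
    refine ⟨?_, ?_, ?_⟩
    · rcases h3 with h3 | h3
      · exact Or.inl h3
      · right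
        show (y, -(x + 1) - y) ∈ K
        convert h3 using 2; ring
    · rcases h1 with h3 | h3
      · exact Or.inl h3
      · right
        show (y + 1, -(x - 1) - (y + 1)) ∈ K
        convert h3 using 2; ring
    · rcases h2 with h3 | h3
      · exact Or.inl h3
      · right
        show (y - 1, -x - (y - 1)) ∈ K
        convert h3 using 2; ring
  min := by
    intro K' hK' hne hcl
    have key : {p : ℤ × ℤ | (-p.1 - p.2, p.1) ∈ K'} = K := by
      apply h.min
      · rintro ⟨x, y⟩ hp
        have := hK' hp
        simp only [Set.mem_ofPred_eq] at this
        convert this using 2; ring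
      · obtain ⟨⟨x, y⟩, hp⟩ := hne
        refine ⟨(y, -x - y), ?_⟩
        show (-y - (-x - y), y) ∈ K'
        convert hp using 2; ring
      · intro x y hxy
        obtain ⟨h1, h2, h3⟩ := hcl (-x - y) x hxy
        have e : -(-x - y) - x = y := by ring
        simp only [e] at h1 h2 h3
        refine ⟨?_, ?_, ?_⟩
        · rcases h2 with h3 | h3
          · exact Or.inl h3
          · right
            show (-(x + 1) - y, x + 1) ∈ K'
            convert h3 using 2; ring
        · rcases h3 with h3 | h3
          · exact Or.inl h3
          · right
            show (-(x - 1) - (y + 1), x - 1) ∈ K'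
            convert h3 using 2; ring
        · rcases h1 with h3 | h3
          · exact Or.inl h3
          · right
            show (-x - (y - 1), x) ∈ K'
            convert h3 using 2; ring
    ext ⟨x, y⟩
    rw [← key]
    show _ ↔ (-y - (-x - y), y) ∈ K'
    have e : -y - (-x - y) = x := by ring
    rw [e]
  u12 := by
    intro x y hx hy hc h1 h2
    refine h.u13 y (-(x + 1) - y) hy (by omega) (by omega) h2 ?_
    convert h1 using 1; ring
  u13 := by
    intro x y hx hy hc h1 h2
    refine h.u23 y (-x - (y + 1)) hy (by omega) (by omega) h2 ?_
    convert h1 using 1; ring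
  u23 := by
    intro x y hx hy hc h1 h2
    refine h.u12 y (-(x + 1) - y) hy (by omega) (by omega) h1 ?_
    convert h2 using 1; ring
  dn := by
    intro x y hx hy hc
    have := h.dn y (-x - y - 2) hy (by omega) (by omega)
    rcases this with h1 | h1 | h1
    · right; left
      show P1 y (-(x + 1) - y)
      convert h1 using 1; ring
    · right; right
      show P2 (y + 1) (-(x + 1) - (y + 1))
      convert h1 using 1; ring
    · left
      show P3 (y + 1) (-x - (y + 1))
      convert h1 using 1; ring

open Classical in
/-- thresholds of the right-going cut -/
noncomputable def cutR (P1 : ℤ → ℤ → Prop) (x0 s0 : ℤ) : ℕ → ℤ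
  | 0 => x0
  | t + 1 => if P1 (cutR P1 x0 s0 t) (s0 + t - cutR P1 x0 s0 t) then cutR P1 x0 s0 t
      else cutR P1 x0 s0 t + 1

open Classical in
/-- thresholds of the left-going cut -/
noncomputable def cutL (P1 : ℤ → ℤ → Prop) (x0 b : ℤ) : ℕ → ℤ
  | 0 => b
  | t + 1 => if P1 (x0 - t - 1) (cutL P1 x0 b t + 1) then cutL P1 x0 b t + 1
      else cutL P1 x0 b t

theorem cutR_bd (P1 : ℤ → ℤ → Prop) (x0 s0 : ℤ) (t : ℕ) :
    x0 ≤ cutR P1 x0 s0 t ∧ cutR P1 x0 s0 t ≤ x0 + t := by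
  induction t with
  | zero => simp [cutR]
  | succ t ih =>
    rw [cutR]
    push_cast
    split_ifs <;> omega

theorem cutL_bd (P1 : ℤ → ℤ → Prop) (x0 b : ℤ) (t : ℕ) :
    b ≤ cutL P1 x0 b t ∧ cutL P1 x0 b t ≤ b + t := by
  induction t with
  | zero => simp [cutL]
  | succ t ih =>
    rw [cutL]
    push_cast
    split_ifs <;> omega

/-- The right cut: the complement of the corner part is closed. -/
theorem Cfg.cut_right {P1 P2 P3 : ℤ → ℤ → Prop} {K : Set (ℤ × ℤ)} {a b c : ℤ}
    (h : Cfg P1 P2 P3 K a b c) (x0 : ℤ) (hx : a ≤ x0) (hc : x0 + b + 1 ≤ c) (hP : P1 x0 b)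
    (x : ℤ) (hxb : (x, b) ∈ K) : x ≤ x0 := by
  set s0 := x0 + b + 1 with hs0
  set τ := cutR P1 x0 s0 with hτ
  have bd : ∀ t, x0 ≤ τ t ∧ τ t ≤ x0 + t := cutR_bd P1 x0 s0
  have rec1 : ∀ t : ℕ, (P1 (τ t) (s0 + t - τ t) ∧ τ (t + 1) = τ t) ∨
      (¬ P1 (τ t) (s0 + t - τ t) ∧ τ (t + 1) = τ t + 1) := by
    intro t
    by_cases hp : P1 (τ t) (s0 + t - τ t)
    · exact Or.inl ⟨hp, by rw [hτ, cutR, if_pos hp]⟩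
    · exact Or.inr ⟨hp, by rw [hτ, cutR, if_neg hp]⟩
  -- the up cell is matched through its bottom or its left edge
  have inv : ∀ t : ℕ, s0 + t ≤ c → P1 (τ t) (s0 + t - 1 - τ t) ∨ P3 (τ t) (s0 + t - τ t) := by
    intro t
    induction t with
    | zero =>
      intro _
      left
      have : τ 0 = x0 := rfl
      rw [this]
      convert hP using 1
      push_cast; omega
    | succ t ih =>
      intro hle
      push_cast at hle ⊢
      have bt := bd t
      rcases rec1 t with ⟨hp, he⟩ | ⟨hp, he⟩
      · left
        rw [he]
        convert hp using 1; ring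
      · right
        rw [he]
        have i1 := ih (by omega)
        have d1 := h.dn (τ t) (s0 + t - 1 - τ t) (by omega) (by omega) (by omega)
        have e1 : s0 + t - 1 - τ t + 1 = s0 + t - τ t := by ring
        rw [e1] at d1
        rcases d1 with d1 | d1 | d1
        · exact absurd d1 hp
        · exfalso
          rcases i1 with i1 | i1
          · exact h.u12 _ _ (by omega) (by omega) (by omega) i1 d1
          · refine h.u23 _ _ (by omega) (by omega) (by omega) d1 ?_
            rw [e1]; exact i1
        · convert d1 using 1; ring
  have inv3 : ∀ t : ℕ, s0 + t + 1 ≤ c → τ (t + 1) = τ t + 1 → P3 (τ t + 1) (s0 + t - τ t) := by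
    intro t hle he
    have bt := bd t
    rcases rec1 t with ⟨hp, he'⟩ | ⟨hp, he'⟩
    · omega
    have i1 := inv t (by omega)
    have d1 := h.dn (τ t) (s0 + t - 1 - τ t) (by omega) (by omega) (by omega)
    have e1 : s0 + t - 1 - τ t + 1 = s0 + t - τ t := by ring
    rw [e1] at d1
    rcases d1 with d1 | d1 | d1
    · exact absurd d1 hp
    · exfalso
      rcases i1 with i1 | i1
      · exact h.u12 _ _ (by omega) (by omega) (by omega) i1 d1
      · refine h.u23 _ _ (by omega) (by omega) (by omega) d1 ?_
        rw [e1]; exact i1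
    · exact d1
  have inv1 : ∀ t : ℕ, τ (t + 1) = τ t → P1 (τ t) (s0 + t - τ t) := by
    intro t he
    rcases rec1 t with ⟨hp, he'⟩ | ⟨hp, he'⟩
    · exact hp
    · omega
  have key : {p : ℤ × ℤ | p ∈ K ∧ ∀ t : ℕ, p.1 + p.2 = s0 + t → p.1 ≤ τ t} = K := by
    apply h.min
    · exact fun p hp => hp.1
    · obtain ⟨y, hy⟩ := h.left
      refine ⟨(a, y), hy, fun t _ => ?_⟩
      have := (bd t).1
      simp only; omega
    · rintro x y ⟨hk, hq⟩
      simp only at hq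
      obtain ⟨h1, h2, h3⟩ := h.closed x y hk
      have hb := h.sub _ _ hk
      refine ⟨?_, ?_, ?_⟩
      · rcases h1 with h1 | h1
        · exact Or.inl h1
        by_contra hcon
        push Not at hcon
        obtain ⟨n1, n2⟩ := hcon
        apply n2
        refine ⟨h1, ?_⟩
        intro t ht
        simp only at ht ⊢
        by_contra hlt
        push Not at hlt
        rcases t with _ | t
        · have : τ 0 = x0 := rfl
          rw [this] at hlt
          push_cast at ht
          apply n1
          have ex : x = x0 := by omega
          have ey : y = b := by omega
          rw [ex, ey]; exact hP
        · push_cast at ht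
          have q := hq t (by omega)
          have bt := bd t
          rcases rec1 t with ⟨hp, he⟩ | ⟨hp, he⟩
          · apply n1
            have ex : x = τ t := by omega
            have ey : y = s0 + t - τ t := by omega
            rw [ex, ey]; exact hp
          · omega
      · rcases h2 with h2 | h2
        · exact Or.inl h2
        right
        refine ⟨h2, fun t ht => ?_⟩
        simp only at ht ⊢
        have := hq t (by omega)
        omega
      · rcases h3 with h3 | h3
        · exact Or.inl h3
        by_contra hcon
        push Not at hcon
        obtain ⟨n1, n2⟩ := hcon
        apply n2
        refine ⟨h3, ?_⟩
        intro t ht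
        simp only at ht ⊢
        by_contra hlt
        push Not at hlt
        have q := hq (t + 1) (by push_cast; omega)
        rcases rec1 t with ⟨hp, he⟩ | ⟨hp, he⟩
        · omega
        · apply n1
          have i3 := inv3 t (by omega) he
          have ex : x = τ t + 1 := by omega
          have ey : y = s0 + t - τ t := by omega
          rw [ex, ey]; exact i3
  have hm := hxb
  rw [← key] at hm
  by_contra hlt
  push Not at hlt
  have := hm.2 (x - x0 - 1).toNat (by simp only; omega)
  have b2 := (bd (x - x0 - 1).toNat).2
  simp only at this
  omega

/-- The left cut: the corner part is closed. -/
theorem Cfg.cut_left {P1 P2 P3 : ℤ → ℤ → Prop} {K : Set (ℤ × ℤ)} {a b c : ℤ}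
    (h : Cfg P1 P2 P3 K a b c) (x0 : ℤ) (hx : a ≤ x0) (hc : x0 + b + 1 ≤ c) (hP : P1 x0 b)
    (x : ℤ) (hxb : (x, b) ∈ K) : x0 < x := by
  set σ := cutL P1 x0 b with hσ
  have bd : ∀ t, b ≤ σ t ∧ σ t ≤ b + t := cutL_bd P1 x0 b
  have rec1 : ∀ t : ℕ, (P1 (x0 - t - 1) (σ t + 1) ∧ σ (t + 1) = σ t + 1) ∨
      (¬ P1 (x0 - t - 1) (σ t + 1) ∧ σ (t + 1) = σ t) := by
    intro t
    by_cases hp : P1 (x0 - t - 1) (σ t + 1)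
    · exact Or.inl ⟨hp, by rw [hσ, cutL, if_pos hp]⟩
    · exact Or.inr ⟨hp, by rw [hσ, cutL, if_neg hp]⟩
  -- the up cell `(x0 - t, σ t)` is matched through its bottom or its right edge
  have inv : ∀ t : ℕ, a ≤ x0 - t → P1 (x0 - t) (σ t) ∨ P2 (x0 - t + 1) (σ t) := by
    intro t
    induction t with
    | zero =>
      intro _
      left
      have : σ 0 = b := rfl
      rw [this]
      simpa using hP
    | succ t ih =>
      intro hle
      push_cast at hle ⊢
      have bt := bd t
      have e2 : x0 - (t + 1 : ℤ) = x0 - t - 1 := by ring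
      rw [e2]
      rcases rec1 t with ⟨hp, he⟩ | ⟨hp, he⟩
      · left
        rw [he]; exact hp
      · right
        rw [he]
        have i1 := ih (by omega)
        have d1 := h.dn (x0 - t - 1) (σ t) (by omega) (by omega) (by omega)
        have e1 : x0 - (t : ℤ) - 1 + 1 = x0 - t := by ring
        rw [e1] at d1 ⊢
        rcases d1 with d1 | d1 | d1
        · exact absurd d1 hp
        · exact d1
        · exfalso
          rcases i1 with i1 | i1
          · exact h.u13 _ _ (by omega) (by omega) (by omega) i1 d1
          · exact h.u23 _ _ (by omega) (by omega) (by omega) i1 d1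
  by_contra hlt
  push Not at hlt
  have key : {p : ℤ × ℤ | p ∈ K ∧ ∃ t : ℕ, p.1 = x0 - t ∧ p.2 ≤ σ t} = K := by
    apply h.min
    · exact fun p hp => hp.1
    · refine ⟨(x, b), hxb, (x0 - x).toNat, by simp only; omega, (bd _).1⟩
    · rintro x y ⟨hk, t, ht, hq⟩
      simp only at hq ht
      obtain ⟨h1, h2, h3⟩ := h.closed x y hk
      have hb := h.sub _ _ hk
      have bt := bd t
      refine ⟨?_, ?_, ?_⟩
      · rcases h1 with h1 | h1
        · exact Or.inl h1
        rcases t with _ | t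
        · left
          have : σ 0 = b := rfl
          rw [this] at hq
          have ex : x = x0 := by simpa using ht
          have ey : y = b := by omega
          rw [ex, ey]; exact hP
        · push_cast at ht
          by_cases hy : y ≤ σ t
          · right
            exact ⟨h1, t, by simp only; omega, hy⟩
          · left
            rcases rec1 t with ⟨hp, he⟩ | ⟨hp, he⟩
            · have ex : x = x0 - t - 1 := by omega
              have ey : y = σ t + 1 := by omega
              rw [ex, ey]; exact hp
            · omega
      · rcases h2 with h2 | h2
        · exact Or.inl h2
        have hb2 := h.sub _ _ h2
        by_cases hy : y + 1 ≤ σ (t + 1)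
        · right
          exact ⟨h2, t + 1, by simp only; push_cast; omega, hy⟩
        · left
          have i2 := inv (t + 1) (by push_cast; omega)
          rcases rec1 t with ⟨hp, he⟩ | ⟨hp, he⟩
          · omega
          · have bt := bd t
            have i1 := inv t (by omega)
            have d1 := h.dn (x0 - t - 1) (σ t) (by omega) (by omega) (by omega)
            have e1 : x0 - (t : ℤ) - 1 + 1 = x0 - t := by ring
            rw [e1] at d1
            have ey : y = σ t := by omega
            rw [ht, ey]
            rcases d1 with d1 | d1 | d1
            · exact absurd d1 hp
            · exact d1
            · exfalso
              rcases i1 with i1 | i1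
              · exact h.u13 _ _ (by omega) (by omega) (by omega) i1 d1
              · exact h.u23 _ _ (by omega) (by omega) (by omega) i1 d1
      · rcases h3 with h3 | h3
        · exact Or.inl h3
        right
        exact ⟨h3, t, ht, by simp only; omega⟩
  obtain ⟨xr, hr⟩ := h.right
  rw [← key] at hr
  obtain ⟨_, t, ht, hq⟩ := hr
  have := bd t
  simp only at ht hq
  omega

theorem Cfg.not_P1 {P1 P2 P3 : ℤ → ℤ → Prop} {K : Set (ℤ × ℤ)} {a b c : ℤ}
    (h : Cfg P1 P2 P3 K a b c) (x0 : ℤ) (hx : a ≤ x0) (hc : x0 + b + 1 ≤ c) : ¬ P1 x0 b := by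
  intro hP
  obtain ⟨x, hxb⟩ := h.bot
  have h1 := h.cut_right x0 hx hc hP x hxb
  have h2 := h.cut_left x0 hx hc hP x hxb
  omega

/-- a bottom point gives the right corner -/
theorem Cfg.corner {P1 P2 P3 : ℤ → ℤ → Prop} {K : Set (ℤ × ℤ)} {a b c : ℤ}
    (h : Cfg P1 P2 P3 K a b c) (x : ℤ) (hx : (x, b) ∈ K) (t : ℕ) :
    x + t + b ≤ c → (x + t, b) ∈ K := by
  induction t with
  | zero => intro _; simpa using hx
  | succ t ih =>
    intro hle
    push_cast at hle ⊢
    have i1 := ih (by omega)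
    have hb := h.sub _ _ i1
    rcases (h.closed _ _ i1).1 with h1 | h1
    · exact absurd h1 (h.not_P1 _ (by omega) (by omega))
    · rwa [← add_assoc]

theorem Cfg.corner_mem {P1 P2 P3 : ℤ → ℤ → Prop} {K : Set (ℤ × ℤ)} {a b c : ℤ}
    (h : Cfg P1 P2 P3 K a b c) : (c - b, b) ∈ K := by
  obtain ⟨x, hx⟩ := h.bot
  have hb := h.sub _ _ hx
  have := h.corner x hx (c - b - x).toNat (by omega)
  convert this using 2
  omega

theorem Cfg.bottom {P1 P2 P3 : ℤ → ℤ → Prop} {K : Set (ℤ × ℤ)} {a b c : ℤ}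
    (h : Cfg P1 P2 P3 K a b c) (x : ℤ) (hx : a ≤ x) (hc : x + b ≤ c) : P3 x b := by
  have h2 := h.rot.corner_mem
  have h3 : (a, b) ∈ K := by
    simp only [Set.mem_ofPred_eq] at h2
    convert h2 using 2 <;> ring
  have h4 := h.corner a h3 (x - a).toNat (by omega)
  have e : a + ((x - a).toNat : ℤ) = x := by omega
  rw [e] at h4
  rcases (h.closed _ _ h4).2.2 with h5 | h5
  · exact h5
  · have := h.sub _ _ h5
    omega

/-- `f` rotates the ring `(a,b,m)` counterclockwise (explicit form). -/
def RingData (f : ℕ × ℕ → ℕ × ℕ) (a b m : ℕ) : Prop :=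
  (∀ j, b + 1 ≤ j → j + 2 ≤ b + m → f (a, j) = (a, j)) ∧
  (∀ i, a ≤ i → i + 3 ≤ a + m → f (i, b) = (i + 1, b)) ∧
  (∀ i j, i + j + 2 = a + b + m → a + 1 ≤ i → b ≤ j → f (i, j) = (i, j + 1))

def PA (f : ℕ × ℕ → ℕ × ℕ) (x y : ℤ) : Prop :=
  f (x.toNat + 1, y.toNat) = (x.toNat + 1, y.toNat + 1)

def PB (f : ℕ × ℕ → ℕ × ℕ) (x y : ℤ) : Prop :=
  f (x.toNat, y.toNat + 1) = (x.toNat, y.toNat + 1)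

def PC (f : ℕ × ℕ → ℕ × ℕ) (x y : ℤ) : Prop :=
  f (x.toNat, y.toNat) = (x.toNat + 1, y.toNat)

theorem exists_ring (n : ℕ) (S : Set (ℕ × ℕ)) (f : ℕ × ℕ → ℕ × ℕ) (hf : IsTiling n S f)
    (M : Set (ℤ × ℤ)) (hne : M.Nonempty)
    (hsub : ∀ x y, (x, y) ∈ M → 0 ≤ x ∧ 0 ≤ y ∧ x + y + 3 ≤ n)
    (hcl : Closed3 (PA f) (PB f) (PC f) M) :
    ∃ a b m, 3 ≤ m ∧ a + b + m ≤ n ∧ RingData f a b m := by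
  have hfin : M.Finite := by
    apply (Set.finite_Icc ((0, 0) : ℤ × ℤ) (n, n)).subset
    rintro ⟨x, y⟩ hp
    have := hsub x y hp
    simp only [Set.mem_Icc, Prod.mk_le_mk]
    omega
  have hF : {K : Set (ℤ × ℤ) | K ⊆ M ∧ K.Nonempty ∧ Closed3 (PA f) (PB f) (PC f) K}.Finite :=
    hfin.finite_subsets.subset (fun K hK => hK.1)
  obtain ⟨K, hK⟩ := hF.exists_minimal ⟨M, subset_rfl, hne, hcl⟩
  obtain ⟨⟨hKM, hKne, hKcl⟩, hKmin⟩ := hK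
  have hKfin := hfin.subset hKM
  obtain ⟨⟨a, ya⟩, hpa, hpa'⟩ := Set.exists_min_image K (fun p => p.1) hKfin hKne
  obtain ⟨⟨xb, b⟩, hpb, hpb'⟩ := Set.exists_min_image K (fun p => p.2) hKfin hKne
  obtain ⟨⟨xc, yc⟩, hpc, hpc'⟩ := Set.exists_max_image K (fun p => p.1 + p.2) hKfin hKne
  have ba := hsub _ _ (hKM hpa)
  have bb := hsub _ _ (hKM hpb)
  have bc := hsub _ _ (hKM hpc)
  have inj := hf.1.injOn
  have down : ∀ i j : ℕ, i + j + 2 ≤ n → (i, j) ∈ DownTri n := fun i j h => h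
  have cfg : Cfg (PA f) (PB f) (PC f) K a b (xc + yc) := by
    constructor
    · intro x y h
      exact ⟨hpa' _ h, hpb' _ h, hpc' _ h⟩
    · exact ⟨ya, hpa⟩
    · exact ⟨xb, hpb⟩
    · exact ⟨xc, by simpa using hpc⟩
    · exact hKcl
    · intro K' hK' hne' hcl'
      exact subset_antisymm hK' (hKmin ⟨hK'.trans hKM, hne', hcl'⟩ hK')
    · intro x y hx hy hc h1 h2
      lift x to ℕ using by omega
      lift y to ℕ using by omega
      have e : ((x : ℤ) + 1).toNat = x + 1 := by omega
      simp only [PA, PB, Int.toNat_natCast, e] at h1 h2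
      have := inj (down _ _ (by omega)) (down _ _ (by omega)) (h1.trans h2.symm)
      simp at this
    · intro x y hx hy hc h1 h2
      lift x to ℕ using by omega
      lift y to ℕ using by omega
      have e : ((y : ℤ) + 1).toNat = y + 1 := by omega
      simp only [PA, PC, Int.toNat_natCast, e] at h1 h2
      have := inj (down _ _ (by omega)) (down _ _ (by omega)) (h1.trans h2.symm)
      simp at this
    · intro x y hx hy hc h1 h2
      lift x to ℕ using by omega
      lift y to ℕ using by omega
      have e : ((y : ℤ) + 1).toNat = y + 1 := by omega
      have e' : ((x : ℤ) + 1).toNat = x + 1 := by omega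
      simp only [PB, PC, Int.toNat_natCast, e, e'] at h1 h2
      have := inj (down _ _ (by omega)) (down _ _ (by omega)) (h1.trans h2.symm)
      simp at this
    · intro x y hx hy hc
      lift x to ℕ using by omega
      lift y to ℕ using by omega
      have e : ((y : ℤ) + 1).toNat = y + 1 := by omega
      have e' : ((x : ℤ) + 1).toNat = x + 1 := by omega
      simp only [PA, PB, PC, Int.toNat_natCast, e, e']
      rcases hf.2 (x + 1, y + 1) (down _ _ (by omega)) with h | h | h
      · exact Or.inr (Or.inl h)
      · exact Or.inr (Or.inr h)
      · exact Or.inl h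
  have r1 := cfg.bottom
  have r2 := cfg.rot.bottom
  have r3 := cfg.rot.rot.bottom
  have sa := cfg.sub _ _ hpa
  have sb := cfg.sub _ _ hpb
  have sc := cfg.sub _ _ hpc
  have hcor := cfg.sub _ _ cfg.corner_mem
  obtain ⟨c, hc⟩ : ∃ c, c = xc + yc := ⟨_, rfl⟩
  rw [← hc] at r1 r2 r3 hcor
  have bc' : 0 ≤ c ∧ c + 3 ≤ n := by omega
  clear hpa' hpb' hpc' cfg
  lift a to ℕ using by omega
  lift b to ℕ using by omega
  lift c to ℕ using by omega
  refine ⟨a, b, c + 3 - a - b, by omega, by omega, ?_, ?_, ?_⟩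
  · intro j h1 h2
    obtain ⟨j, rfl⟩ : ∃ j', j = j' + 1 := ⟨j - 1, by omega⟩
    have := r2 (-a - j) (by omega) (by omega)
    simp only [PB] at this
    have e : (-(-(a : ℤ) - j) - a).toNat = j := by omega
    simpa [e] using this
  · intro i h1 h2
    have := r1 i (by omega) (by omega)
    simpa [PC] using this
  · intro i j h h1 h2
    obtain ⟨i, rfl⟩ : ∃ i', i = i' + 1 := ⟨i - 1, by omega⟩
    have := r3 j (by omega) (by omega)
    simp only [PA] at this
    have e1 : (-(j : ℤ) - -(c : ℤ)).toNat = i := by omega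
    have e2 : (- -(c : ℤ) - (-(j : ℤ) - -(c : ℤ))).toNat = j := by omega
    have e3 : (-(-(c : ℤ)) - (-(j : ℤ) - -(c : ℤ))) = j := by omega
    first
      | simpa [e1, e2] using this
      | (have e4 : (-(j : ℤ) + c).toNat = i := by omega
         simpa [e4] using this)

theorem mem_ringDown {a b m : ℕ} (hm : 3 ≤ m) (i j : ℕ) : (i, j) ∈ RingDown a b m ↔
    a ≤ i ∧ b ≤ j ∧ i + j + 2 ≤ a + b + m ∧ (i = a ∨ j = b ∨ i + j + 2 = a + b + m) := by
  simp only [RingDown, DownCells, Set.mem_sdiff, Set.mem_ofPred_eq]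
  omega

theorem mem_ringUp {a b m : ℕ} (hm : 3 ≤ m) (i j : ℕ) : (i, j) ∈ RingUp a b m ↔
    a ≤ i ∧ b ≤ j ∧ i + j + 1 ≤ a + b + m ∧ (i = a ∨ j = b ∨ i + j + 1 = a + b + m) ∧
    ¬ (i = a ∧ j = b) ∧ ¬ (i + 1 = a + m ∧ j = b) ∧ ¬ (i = a ∧ j + 1 = b + m) := by
  simp only [RingUp, UpCells, Set.mem_sdiff, Set.mem_ofPred_eq, Set.mem_union, Set.mem_insert_iff,
    Set.mem_singleton_iff, Prod.mk.injEq]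
  omega

/-- the clockwise map on the ring -/
def cwMap (a b m : ℕ) (d : ℕ × ℕ) : ℕ × ℕ :=
  if d.1 = a ∧ d.2 + 3 ≤ b + m then (a, d.2 + 1) else if d.2 = b then d else (d.1 + 1, d.2)

/-- the counterclockwise map on the ring -/
def ccwMap (a b m : ℕ) (d : ℕ × ℕ) : ℕ × ℕ :=
  if d.2 = b ∧ d.1 + 3 ≤ a + m then (d.1 + 1, b) else if d.1 = a then d else (d.1, d.2 + 1)

theorem cw_bij (a b m : ℕ) (hm : 3 ≤ m) :
    Set.BijOn (cwMap a b m) (RingDown a b m) (RingUp a b m) := by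
  refine ⟨?_, ?_, ?_⟩
  · rintro ⟨i, j⟩ h
    rw [mem_ringDown hm] at h
    unfold cwMap
    split_ifs with h1 h2 <;> simp only at * <;> rw [mem_ringUp hm] <;> omega
  · rintro ⟨i, j⟩ h ⟨i', j'⟩ h' he
    rw [mem_ringDown hm] at h h'
    unfold cwMap at he
    split_ifs at he <;> simp only [Prod.mk.injEq] at * <;> omega
  · rintro ⟨i, j⟩ h
    rw [mem_ringUp hm] at h
    by_cases c1 : i = a
    · refine ⟨(i, j - 1), ?_, ?_⟩
      · rw [mem_ringDown hm]; omega
      · unfold cwMap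
        rw [if_pos (by simp only; omega)]
        simp only [Prod.mk.injEq]; omega
    by_cases c2 : j = b
    · refine ⟨(i, j), ?_, ?_⟩
      · rw [mem_ringDown hm]; omega
      · unfold cwMap
        rw [if_neg (by simp only; omega), if_pos c2]
    · refine ⟨(i - 1, j), ?_, ?_⟩
      · rw [mem_ringDown hm]; omega
      · unfold cwMap
        rw [if_neg (by simp only; omega), if_neg c2]
        simp only [Prod.mk.injEq, and_true, true_and]; omega

theorem ccw_bij (a b m : ℕ) (hm : 3 ≤ m) :
    Set.BijOn (ccwMap a b m) (RingDown a b m) (RingUp a b m) := by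
  refine ⟨?_, ?_, ?_⟩
  · rintro ⟨i, j⟩ h
    rw [mem_ringDown hm] at h
    unfold ccwMap
    split_ifs with h1 h2 <;> simp only at * <;> rw [mem_ringUp hm] <;> omega
  · rintro ⟨i, j⟩ h ⟨i', j'⟩ h' he
    rw [mem_ringDown hm] at h h'
    unfold ccwMap at he
    split_ifs at he <;> simp only [Prod.mk.injEq] at * <;> omega
  · rintro ⟨i, j⟩ h
    rw [mem_ringUp hm] at h
    by_cases c1 : j = b
    · refine ⟨(i - 1, j), ?_, ?_⟩
      · rw [mem_ringDown hm]; omega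
      · unfold ccwMap
        rw [if_pos (by simp only; omega)]
        simp only [Prod.mk.injEq]; omega
    by_cases c2 : i = a
    · refine ⟨(i, j), ?_, ?_⟩
      · rw [mem_ringDown hm]; omega
      · unfold ccwMap
        rw [if_neg (by simp only; omega), if_pos c2]
    · refine ⟨(i, j - 1), ?_, ?_⟩
      · rw [mem_ringDown hm]; omega
      · unfold ccwMap
        rw [if_neg (by simp only; omega), if_neg c2]
        simp only [Prod.mk.injEq, and_true, true_and]; omega

theorem RingData.eqOn {f : ℕ × ℕ → ℕ × ℕ} {a b m : ℕ} (hm : 3 ≤ m) (h : RingData f a b m) :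
    Set.EqOn f (ccwMap a b m) (RingDown a b m) := by
  rintro ⟨i, j⟩ hd
  rw [mem_ringDown hm] at hd
  obtain ⟨h1, h2, h3⟩ := h
  unfold ccwMap
  split_ifs with c1 c2
  · simp only at *
    rw [c1.1]; exact h2 i (by omega) (by omega)
  · simp only at *
    rw [c2]; exact h1 j (by omega) (by omega)
  · simp only at *
    exact h3 i j (by omega) (by omega) (by omega)

theorem exists_flip (n : ℕ) (S : Set (ℕ × ℕ)) (f : ℕ × ℕ → ℕ × ℕ) (hf : IsTiling n S f)
    (a b m : ℕ) (hm : 3 ≤ m) (hn : a + b + m ≤ n) (hr : RingData f a b m) :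
    ∃ g, IsTiling n S g ∧ GDFlipAt n g f a b m := by
  classical
  have hfe := hr.eqOn hm
  have bf : Set.BijOn f (RingDown a b m) (RingUp a b m) := (ccw_bij a b m hm).congr hfe.symm
  have hsubD : RingDown a b m ⊆ DownTri n := by
    rintro ⟨i, j⟩ h
    rw [mem_ringDown hm] at h
    show i + j + 2 ≤ n
    omega
  let g : ℕ × ℕ → ℕ × ℕ := fun d => if d ∈ RingDown a b m then cwMap a b m d else f d
  have ge : Set.EqOn g (cwMap a b m) (RingDown a b m) := fun d hd => if_pos hd
  have gn : ∀ d, d ∉ RingDown a b m → g d = f d := fun d hd => if_neg hd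
  have bg : Set.BijOn g (RingDown a b m) (RingUp a b m) := (cw_bij a b m hm).congr ge.symm
  have h00 : (a, b) ∈ RingDown a b m := by rw [mem_ringDown hm]; omega
  have im : f '' (DownTri n \ RingDown a b m) = (UpTri n \ S) \ RingUp a b m := by
    rw [hf.1.injOn.image_sdiff_subset hsubD, hf.1.image_eq, bf.image_eq]
  have hsubU : RingUp a b m ⊆ UpTri n \ S := by
    rw [← bf.image_eq, ← hf.1.image_eq]
    exact Set.image_mono hsubD
  have b2 : Set.BijOn g (DownTri n \ RingDown a b m) ((UpTri n \ S) \ RingUp a b m) := by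
    have : Set.BijOn f (DownTri n \ RingDown a b m) ((UpTri n \ S) \ RingUp a b m) := by
      rw [← im]
      exact (hf.1.injOn.mono Set.sdiff_subset).bijOn_image
    exact this.congr (fun d hd => (gn d hd.2).symm)
  have gt : IsTiling n S g := by
    constructor
    · have := bg.union b2 ?_
      · rwa [Set.union_sdiff_cancel hsubD, Set.union_sdiff_cancel hsubU] at this
      · rw [Set.injOn_union Set.disjoint_sdiff_right]
        refine ⟨bg.injOn, b2.injOn, ?_⟩
        intro x hx y hy he
        have h1 := bg.mapsTo hx
        have h2 := b2.mapsTo hy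
        rw [he] at h1
        exact h2.2 h1
    · rintro ⟨i, j⟩ hd
      by_cases hR : (i, j) ∈ RingDown a b m
      · rw [ge hR]
        unfold cwMap Adj
        split_ifs with c1 c2
        · right; right
          simp only at *
          rw [c1.1]
        · exact Or.inl rfl
        · exact Or.inr (Or.inl rfl)
      · rw [gn _ hR]; exact hf.2 _ hd
  refine ⟨g, gt, hm, hn, ⟨bg.image_eq, ?_⟩, ⟨bf.image_eq, ?_⟩, ⟨S, gt, hf⟩, ?_⟩
  · rw [ge h00]
    unfold cwMap
    rw [if_pos ⟨rfl, by simp only; omega⟩]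
  · rw [hfe h00]
    unfold ccwMap
    rw [if_pos ⟨rfl, by simp only; omega⟩]
  · intro d _ hd
    exact (gn d hd).symm

open Classical in
/-- indicator of the three types of rhombi -/
noncomputable def indO (n : ℕ) (f : ℕ × ℕ → ℕ × ℕ) (i j : ℕ) : ℤ :=
  if i + j + 2 ≤ n ∧ f (i, j) = (i, j) then 1 else 0

open Classical in
noncomputable def indX (n : ℕ) (f : ℕ × ℕ → ℕ × ℕ) (i j : ℕ) : ℤ :=
  if i + j + 2 ≤ n ∧ f (i, j) = (i + 1, j) then 1 else 0

open Classical in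
noncomputable def indY (n : ℕ) (f : ℕ × ℕ → ℕ × ℕ) (i j : ℕ) : ℤ :=
  if i + j + 2 ≤ n ∧ f (i, j) = (i, j + 1) then 1 else 0

noncomputable def prevX (n : ℕ) (f : ℕ × ℕ → ℕ × ℕ) (i j : ℕ) : ℤ :=
  match i with
  | 0 => 0
  | i + 1 => indX n f i j

noncomputable def prevY (n : ℕ) (f : ℕ × ℕ → ℕ × ℕ) (i j : ℕ) : ℤ :=
  match j with
  | 0 => 0
  | j + 1 => indY n f i j

open Classical in
theorem ind_down (n : ℕ) (S : Set (ℕ × ℕ)) (f : ℕ × ℕ → ℕ × ℕ) (hf : IsTiling n S f) (i j : ℕ) :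
    indO n f i j + indX n f i j + indY n f i j = if i + j + 2 ≤ n then 1 else 0 := by
  unfold indO indX indY
  by_cases h : i + j + 2 ≤ n
  · rcases hf.2 (i, j) h with e | e | e <;> simp [h, e]
  · simp [h]

open Classical in
theorem ind_up (n : ℕ) (S : Set (ℕ × ℕ)) (f : ℕ × ℕ → ℕ × ℕ) (hf : IsTiling n S f) (i j : ℕ) :
    indO n f i j + prevX n f i j + prevY n f i j =
      if (i, j) ∈ UpTri n \ S then 1 else 0 := by
  have inj : ∀ a b c d : ℕ, a + b + 2 ≤ n → c + d + 2 ≤ n → f (a, b) = f (c, d) →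
      a = c ∧ b = d := by
    intro a b c d h1 h2 h3
    have := hf.1.injOn (show (a, b) ∈ DownTri n from h1) (show (c, d) ∈ DownTri n from h2) h3
    simpa using this
  have p1 : indO n f i j = 1 ∨ indO n f i j = 0 := by unfold indO; split_ifs <;> simp
  have p2 : prevX n f i j = 1 ∨ prevX n f i j = 0 := by
    unfold prevX indX; cases i <;> simp only <;> [skip; split_ifs] <;> simp
  have p3 : prevY n f i j = 1 ∨ prevY n f i j = 0 := by
    unfold prevY indY; cases j <;> simp only <;> [skip; split_ifs] <;> simp
  have q1 : indO n f i j = 1 ↔ i + j + 2 ≤ n ∧ f (i, j) = (i, j) := by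
    unfold indO; split_ifs with h <;> simp [h]
  have q2 : prevX n f i j = 1 ↔ ∃ i', i = i' + 1 ∧ i' + j + 2 ≤ n ∧ f (i', j) = (i, j) := by
    unfold prevX indX
    cases i with
    | zero => simp
    | succ i => simp
  have q3 : prevY n f i j = 1 ↔ ∃ j', j = j' + 1 ∧ i + j' + 2 ≤ n ∧ f (i, j') = (i, j) := by
    unfold prevY indY
    cases j with
    | zero => simp
    | succ j => simp
  have n12 : ¬ (indO n f i j = 1 ∧ prevX n f i j = 1) := by
    rw [q1, q2]
    rintro ⟨⟨h1, h2⟩, i', h3, h4, h5⟩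
    have := inj _ _ _ _ h1 h4 (h2.trans h5.symm)
    clear q1 q2 q3
    omega
  have n13 : ¬ (indO n f i j = 1 ∧ prevY n f i j = 1) := by
    rw [q1, q3]
    rintro ⟨⟨h1, h2⟩, i', h3, h4, h5⟩
    have := inj _ _ _ _ h1 h4 (h2.trans h5.symm)
    clear q1 q2 q3
    omega
  have n23 : ¬ (prevX n f i j = 1 ∧ prevY n f i j = 1) := by
    rw [q2, q3]
    rintro ⟨⟨j', h0, h1, h2⟩, i', h3, h4, h5⟩
    have := inj _ _ _ _ h1 h4 (h2.trans h5.symm)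
    clear q1 q2 q3
    omega
  split_ifs with hu
  · obtain ⟨⟨p, q⟩, hd, he⟩ := hf.1.surjOn hu
    have : indO n f i j = 1 ∨ prevX n f i j = 1 ∨ prevY n f i j = 1 := by
      rw [q1, q2, q3]
      have hd' : p + q + 2 ≤ n := hd
      have := hf.2 _ hd
      rw [he] at this
      rcases this with e | e | e
      · simp only [Prod.mk.injEq] at e
        obtain ⟨rfl, rfl⟩ := e
        exact Or.inl ⟨hd', he⟩
      · simp only [Prod.mk.injEq] at e
        obtain ⟨rfl, rfl⟩ := e
        exact Or.inr (Or.inl ⟨p, rfl, hd', he⟩)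
      · simp only [Prod.mk.injEq] at e
        obtain ⟨rfl, rfl⟩ := e
        exact Or.inr (Or.inr ⟨q, rfl, hd', he⟩)
    clear q1 q2 q3
    omega
  · have mt : ∀ a b : ℕ, a + b + 2 ≤ n → f (a, b) = (i, j) → False := by
      intro a b h1 h2
      apply hu
      rw [← h2]
      exact hf.1.mapsTo h1
    have m1 : indO n f i j ≠ 1 := by
      rw [Ne, q1]; rintro ⟨h1, h2⟩; exact mt _ _ h1 h2
    have m2 : prevX n f i j ≠ 1 := by
      rw [Ne, q2]; rintro ⟨_, _, h1, h2⟩; exact mt _ _ h1 h2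
    have m3 : prevY n f i j ≠ 1 := by
      rw [Ne, q3]; rintro ⟨_, _, h1, h2⟩; exact mt _ _ h1 h2
    clear q1 q2 q3
    omega

/-- height difference of two tilings at the lattice point `(x+1,y+1)` -/
noncomputable def hgt (n : ℕ) (f g : ℕ × ℕ → ℕ × ℕ) : ℕ → ℕ → ℤ
  | 0, y => indY n g 0 y - indY n f 0 y
  | x + 1, y => hgt n f g x y + (indY n g (x + 1) y - indY n f (x + 1) y)

theorem hgt_neg (n : ℕ) (f g : ℕ × ℕ → ℕ × ℕ) (x y : ℕ) : hgt n g f x y = - hgt n f g x y := by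
  induction x with
  | zero => simp [hgt]
  | succ x ih => rw [hgt, hgt, ih]; ring


theorem hgt_bot {n : ℕ} {S : Set (ℕ × ℕ)} {f g : ℕ × ℕ → ℕ × ℕ}
    (hf : IsTiling n S f) (hg : IsTiling n S g) (x : ℕ) : hgt n f g x 0 = indX n f x 0 - indX n g x 0 := by
  induction x with
  | zero =>
    have a1 := ind_down n S f hf 0 0
    have a2 := ind_down n S g hg 0 0
    have a3 := ind_up n S f hf 0 0
    have a4 := ind_up n S g hg 0 0
    simp only [prevX, prevY] at a3 a4
    rw [hgt]
    linarith
  | succ x ih =>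
    have a1 := ind_down n S f hf (x + 1) 0
    have a2 := ind_down n S g hg (x + 1) 0
    have a3 := ind_up n S f hf (x + 1) 0
    have a4 := ind_up n S g hg (x + 1) 0
    simp only [prevX, prevY] at a3 a4
    rw [hgt]
    linarith

theorem hgt_up {n : ℕ} {S : Set (ℕ × ℕ)} {f g : ℕ × ℕ → ℕ × ℕ}
    (hf : IsTiling n S f) (hg : IsTiling n S g) (x y : ℕ) :
    hgt n f g x (y + 1) = hgt n f g x y + (indX n f x (y + 1) - indX n g x (y + 1)) := by
  induction x with
  | zero =>
    have a1 := ind_down n S f hf 0 (y + 1)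
    have a2 := ind_down n S g hg 0 (y + 1)
    have a3 := ind_up n S f hf 0 (y + 1)
    have a4 := ind_up n S g hg 0 (y + 1)
    simp only [prevX, prevY] at a3 a4
    rw [hgt, hgt]
    linarith
  | succ x ih =>
    have a1 := ind_down n S f hf (x + 1) (y + 1)
    have a2 := ind_down n S g hg (x + 1) (y + 1)
    have a3 := ind_up n S f hf (x + 1) (y + 1)
    have a4 := ind_up n S g hg (x + 1) (y + 1)
    simp only [prevX, prevY] at a3 a4
    rw [hgt, hgt]
    linarith

theorem hgt_left {n : ℕ} {S : Set (ℕ × ℕ)} {f g : ℕ × ℕ → ℕ × ℕ}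
    (hf : IsTiling n S f) (hg : IsTiling n S g) (y : ℕ) : hgt n f g 0 y = indO n f 0 (y + 1) - indO n g 0 (y + 1) := by
  have a3 := ind_up n S f hf 0 (y + 1)
  have a4 := ind_up n S g hg 0 (y + 1)
  simp only [prevX, prevY] at a3 a4
  rw [hgt]
  linarith

theorem hgt_diag {n : ℕ} {S : Set (ℕ × ℕ)} {f g : ℕ × ℕ → ℕ × ℕ}
    (hf : IsTiling n S f) (hg : IsTiling n S g) (x y : ℕ) : hgt n f g x (y + 1) =
    hgt n f g (x + 1) y + (indO n g (x + 1) (y + 1) - indO n f (x + 1) (y + 1)) := by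
  have a1 := ind_down n S f hf (x + 1) (y + 1)
  have a2 := ind_down n S g hg (x + 1) (y + 1)
  have h1 := hgt_up hf hg (x + 1) y
  rw [hgt] at h1
  linarith

theorem hgt_out {n : ℕ} {S : Set (ℕ × ℕ)} {f g : ℕ × ℕ → ℕ × ℕ}
    (hf : IsTiling n S f) (hg : IsTiling n S g) (x : ℕ) : ∀ y, n ≤ x + y + 2 → hgt n f g x y = 0 := by
  induction x with
  | zero =>
    intro y hy
    rw [hgt_left hf hg]
    unfold indO
    rw [if_neg (by omega), if_neg (by omega)]; rfl
  | succ x ih =>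
    intro y hy
    have h1 := hgt_diag hf hg x y
    rw [ih (y + 1) (by omega)] at h1
    unfold indO at h1
    rw [if_neg (by omega), if_neg (by omega)] at h1
    linarith

theorem hgt_nonpos {n : ℕ} {S : Set (ℕ × ℕ)} {f g : ℕ × ℕ → ℕ × ℕ}
    (hf : IsTiling n S f) (hg : IsTiling n S g) (hno : ∀ a b m, 3 ≤ m → a + b + m ≤ n → ¬ RingData f a b m) (x y : ℕ) :
    hgt n f g x y ≤ 0 := by
  by_contra hpos
  push Not at hpos
  let D : Finset (ℕ × ℕ) := Finset.range (n + 1) ×ˢ Finset.range (n + 1)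
  have inD : ∀ x y, 0 < hgt n f g x y → x + y + 3 ≤ n := by
    intro x y h
    by_contra hc
    rw [hgt_out hf hg x y (by omega)] at h
    exact lt_irrefl _ h
  have hxyD : (x, y) ∈ D := by
    have := inD _ _ hpos
    simp only [D, Finset.mem_product, Finset.mem_range]; omega
  obtain ⟨⟨x0, y0⟩, h0, hmax⟩ := D.exists_max_image (fun p => hgt n f g p.1 p.2) ⟨_, hxyD⟩
  simp only at hmax
  have h0pos : 0 < hgt n f g x0 y0 := lt_of_lt_of_le hpos (hmax _ hxyD)
  have hmx : ∀ x y, hgt n f g x y ≤ hgt n f g x0 y0 := by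
    intro x y
    by_cases h : 0 < hgt n f g x y
    · have := inD _ _ h
      exact hmax (x, y) (by simp only [D, Finset.mem_product, Finset.mem_range]; omega)
    · linarith
  obtain ⟨a, b, m, h3, h4, h5⟩ := exists_ring n S f hf
    {p | ∃ i j : ℕ, p = ((i : ℤ), (j : ℤ)) ∧ hgt n f g i j = hgt n f g x0 y0}
    ⟨((x0 : ℤ), (y0 : ℤ)), x0, y0, rfl, rfl⟩ (by
      rintro x y ⟨i, j, he, hh⟩
      simp only [Prod.mk.injEq] at he
      obtain ⟨rfl, rfl⟩ := he
      have := inD i j (by rw [hh]; exact h0pos)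
      omega) (by
      rintro x y ⟨i, j, he, hh⟩
      simp only [Prod.mk.injEq] at he
      obtain ⟨rfl, rfl⟩ := he
      have hb := inD i j (by rw [hh]; exact h0pos)
      have gO : ∀ i j, 0 ≤ indO n g i j := by intro i j; unfold indO; split_ifs <;> simp
      have gX : ∀ i j, 0 ≤ indX n g i j := by intro i j; unfold indX; split_ifs <;> simp
      have gY : ∀ i j, 0 ≤ indY n g i j := by intro i j; unfold indY; split_ifs <;> simp
      refine ⟨?_, ?_, ?_⟩
      · by_cases hp : f (i + 1, j) = (i + 1, j + 1)
        · left; simpa [PA] using hp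
        · right
          refine ⟨i + 1, j, by push_cast; rfl, ?_⟩
          have e : hgt n f g (i + 1) j =
            hgt n f g i j + (indY n g (i + 1) j - indY n f (i + 1) j) := by rw [hgt]
          have z : indY n f (i + 1) j = 0 := by unfold indY; simp [hp]
          have := hmx (i + 1) j
          have := gY (i + 1) j
          linarith
      · by_cases hp : f (i, j + 1) = (i, j + 1)
        · left; simpa [PB] using hp
        · right
          have z : indO n f i (j + 1) = 0 := by unfold indO; simp [hp]
          have gg := gO i (j + 1)
          cases i with
          | zero =>
            exfalso
            have := hgt_left hf hg j
            linarith
          | succ i =>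
            refine ⟨i, j + 1, by push_cast; simp, ?_⟩
            have := hgt_diag hf hg i j
            have := hmx i (j + 1)
            linarith
      · by_cases hp : f (i, j) = (i + 1, j)
        · left; simpa [PC] using hp
        · right
          have z : indX n f i j = 0 := by unfold indX; simp [hp]
          have gg := gX i j
          cases j with
          | zero =>
            exfalso
            have := hgt_bot hf hg i
            linarith
          | succ j =>
            refine ⟨i, j, by push_cast; simp, ?_⟩
            have := hgt_up hf hg i j
            have := hmx i j
            linarith)
  exact hno a b m h3 h4 h5


theorem terminal_unique {n : ℕ} {S : Set (ℕ × ℕ)} {f g : ℕ × ℕ → ℕ × ℕ} (hf : IsTiling n S f)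
    (hg : IsTiling n S g) (hnf : ∀ a b m, 3 ≤ m → a + b + m ≤ n → ¬ RingData f a b m)
    (hng : ∀ a b m, 3 ≤ m → a + b + m ≤ n → ¬ RingData g a b m) :
    Set.EqOn f g (DownTri n) := by
  have h0 : ∀ x y, hgt n f g x y = 0 := by
    intro x y
    have h1 := hgt_nonpos hf hg hnf x y
    have h2 := hgt_nonpos hg hf hng x y
    rw [hgt_neg] at h2
    linarith
  have hX : ∀ x y, indX n f x y = indX n g x y := by
    intro x y
    cases y with
    | zero => have := hgt_bot hf hg x; rw [h0] at this; linarith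
    | succ y => have := hgt_up hf hg x y; rw [h0, h0] at this; linarith
  have hY : ∀ x y, indY n f x y = indY n g x y := by
    intro x y
    cases x with
    | zero => have := h0 0 y; rw [hgt] at this; linarith
    | succ x => have := h0 (x + 1) y; rw [hgt, h0] at this; linarith
  rintro ⟨i, j⟩ hd
  have hd' : i + j + 2 ≤ n := hd
  have a := hX i j
  have b := hY i j
  unfold indX at a
  unfold indY at b
  rcases hf.2 _ hd with e | e | e <;> rcases hg.2 _ hd with e' | e' | e' <;>
    simp [hd', e, e'] at a b ⊢

open Classical in
/-- termination potential -/
noncomputable def pot (n : ℕ) (f : ℕ × ℕ → ℕ × ℕ) : ℕ :=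
  ∑ d ∈ Finset.range n ×ˢ Finset.range n,
    if d.1 + d.2 + 2 ≤ n ∧ f d = (d.1 + 1, d.2) then (n * n + 1) ^ (n - d.1 - d.2) else 0

theorem pot_lt {n : ℕ} {f g : ℕ × ℕ → ℕ × ℕ} {a b m : ℕ} (h : GDFlipAt n g f a b m) :
    pot n g < pot n f := by
  classical
  obtain ⟨hm, hn, ⟨_, hg0⟩, ⟨_, hf0⟩, _, hoff⟩ := h
  set D := Finset.range n ×ˢ Finset.range n with hD
  have hmem : (a, b) ∈ D := by
    simp only [hD, Finset.mem_product, Finset.mem_range]; omega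
  unfold pot
  rw [← Finset.add_sum_erase _ _ hmem, ← Finset.add_sum_erase _ _ hmem]
  rw [if_neg (by rw [hg0]; simp), if_pos ⟨by simp only; omega, hf0⟩, zero_add]
  simp only
  have step : ∀ d ∈ D.erase (a, b),
      (if d.1 + d.2 + 2 ≤ n ∧ g d = (d.1 + 1, d.2) then (n * n + 1) ^ (n - d.1 - d.2) else 0) ≤
      (n * n + 1) ^ (n - a - b - 1) +
      (if d.1 + d.2 + 2 ≤ n ∧ f d = (d.1 + 1, d.2) then (n * n + 1) ^ (n - d.1 - d.2) else 0) := by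
    rintro ⟨i, j⟩ hd
    simp only
    have hne : ¬ (i = a ∧ j = b) := by simpa using (Finset.mem_erase.1 hd).1
    by_cases hin : i + j + 2 ≤ n
    swap
    · simp [hin]
    by_cases hR : (i, j) ∈ RingDown a b m
    · rw [mem_ringDown hm] at hR
      refine le_trans ?_ (Nat.le_add_right _ _)
      split_ifs
      · apply Nat.pow_le_pow_right (by omega)
        omega
      · exact Nat.zero_le _
    · rw [hoff (i, j) hin hR]
      exact Nat.le_add_left _ _
  refine lt_of_le_of_lt (Finset.sum_le_sum step) ?_
  rw [Finset.sum_add_distrib, Finset.sum_const, smul_eq_mul]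
  apply Nat.add_lt_add_right
  have hc : (D.erase (a, b)).card ≤ n * n := by
    refine le_trans (Finset.card_erase_le) ?_
    simp [hD]
  have e : n - a - b = (n - a - b - 1) + 1 := by omega
  calc _ ≤ (n * n) * (n * n + 1) ^ (n - a - b - 1) := Nat.mul_le_mul_right _ hc
    _ < (n * n + 1) * (n * n + 1) ^ (n - a - b - 1) :=
        Nat.mul_lt_mul_of_pos_right (Nat.lt_succ_self _) (by positivity)
    _ = (n * n + 1) ^ (n - a - b) := by rw [e, pow_succ]; simp [mul_comm]

/-- one step between tilings -/
def FStep (n : ℕ) (S : Set (ℕ × ℕ)) (f g : ℕ × ℕ → ℕ × ℕ) : Prop :=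
  IsTiling n S f ∧ IsTiling n S g ∧ (GDFlip n f g ∨ GDFlip n g f)

theorem reach_terminal (n : ℕ) (S : Set (ℕ × ℕ)) : ∀ (N : ℕ) (f : ℕ × ℕ → ℕ × ℕ),
    pot n f = N → IsTiling n S f →
    ∃ t, Relation.ReflTransGen (FStep n S) f t ∧ IsTiling n S t ∧
      ∀ a b m, 3 ≤ m → a + b + m ≤ n → ¬ RingData t a b m := by
  intro N
  induction N using Nat.strong_induction_on with
  | _ N ih =>
    intro f hN hf
    by_cases h : ∀ a b m, 3 ≤ m → a + b + m ≤ n → ¬ RingData f a b m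
    · exact ⟨f, .refl, hf, h⟩
    · push Not at h
      obtain ⟨a, b, m, hm, hn, hr⟩ := h
      obtain ⟨g, hg, hfl⟩ := exists_flip n S f hf a b m hm hn hr
      have hlt := pot_lt hfl
      obtain ⟨t, ht, h1, h2⟩ := ih _ (hN ▸ hlt) g rfl hg
      exact ⟨t, .head ⟨hf, hg, Or.inr ⟨a, b, m, hfl⟩⟩ ht, h1, h2⟩

theorem seq_of_reach {n : ℕ} {S : Set (ℕ × ℕ)} {f g : ℕ × ℕ → ℕ × ℕ} (hf : IsTiling n S f)
    (h : Relation.ReflTransGen (FStep n S) f g) :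
    ∃ (m : ℕ) (F : ℕ → ℕ × ℕ → ℕ × ℕ), F 0 = f ∧ F m = g ∧ (∀ k ≤ m, IsTiling n S (F k)) ∧
      (∀ k < m, GDFlip n (F k) (F (k + 1)) ∨ GDFlip n (F (k + 1)) (F k)) := by
  induction h with
  | refl => exact ⟨0, fun _ => f, rfl, rfl, fun _ _ => hf, fun k hk => absurd hk (by omega)⟩
  | @tail b c _ hbc ih =>
    obtain ⟨m, F, h0, hm, ht, hs⟩ := ih
    refine ⟨m + 1, fun k => if k ≤ m then F k else c, by simp [h0], by simp, ?_, ?_⟩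
    · intro k hk
      by_cases hkm : k ≤ m
      · simp only [hkm, if_true]; exact ht k hkm
      · simp only [hkm, if_false]; exact hbc.2.1
    · intro k hk
      by_cases hkm : k + 1 ≤ m
      · simp only [hkm, (by omega : k ≤ m), if_true]; exact hs k (by omega)
      · have e : k = m := by omega
        subst e
        simp only [hkm, le_refl, if_true, if_false]
        rw [hm]; exact hbc.2.2

theorem FStep.symm {n : ℕ} {S : Set (ℕ × ℕ)} {f g : ℕ × ℕ → ℕ × ℕ} (h : FStep n S f g) :
    FStep n S g f := ⟨h.2.1, h.1, h.2.2.symm⟩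

/-- A tiling may be replaced by one which agrees with it on the downward triangles. -/
theorem isTiling_congr {n : ℕ} {S : Set (ℕ × ℕ)} {f g : ℕ × ℕ → ℕ × ℕ} (hf : IsTiling n S f)
    (h : Set.EqOn f g (DownTri n)) : IsTiling n S g :=
  ⟨hf.1.congr h, fun d hd => by rw [← h hd]; exact hf.2 d hd⟩

theorem gdFlipAt_congr {n : ℕ} {f g f' g' : ℕ × ℕ → ℕ × ℕ} {a b m : ℕ}
    (h : GDFlipAt n f g a b m)
    (hf : Set.EqOn f f' (DownTri n)) (hg : Set.EqOn g g' (DownTri n)) :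
    GDFlipAt n f' g' a b m := by
  obtain ⟨hm, hn, ⟨h1, h2⟩, ⟨h3, h4⟩, ⟨S, h5, h6⟩, h7⟩ := h
  have hsub : RingDown a b m ⊆ DownTri n := by
    rintro ⟨i, j⟩ h
    rw [mem_ringDown hm] at h
    show i + j + 2 ≤ n
    omega
  have h00 : (a, b) ∈ DownTri n := by show a + b + 2 ≤ n; omega
  refine ⟨hm, hn, ⟨?_, ?_⟩, ⟨?_, ?_⟩, ⟨S, isTiling_congr h5 hf, isTiling_congr h6 hg⟩, ?_⟩
  · rw [← h1]; exact (hf.mono hsub).symm.image_eq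
  · rw [← hf h00]; exact h2
  · rw [← h3]; exact (hg.mono hsub).symm.image_eq
  · rw [← hg h00]; exact h4
  · intro d hd hR
    rw [← hf hd, ← hg hd]; exact h7 d hd hR

/-- Transport of a path along agreement on the downward triangles. -/
theorem reach_congr {n : ℕ} {S : Set (ℕ × ℕ)} {s g : ℕ × ℕ → ℕ × ℕ}
    (h : Relation.ReflTransGen (FStep n S) s g) :
    ∀ t, Set.EqOn s t (DownTri n) →
      ∃ g', Relation.ReflTransGen (FStep n S) t g' ∧ Set.EqOn g' g (DownTri n) := by
  induction h with
  | refl => exact fun t ht => ⟨t, .refl, ht.symm⟩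
  | @tail b c _ hbc ih =>
    intro t ht
    obtain ⟨b', hb', he⟩ := ih t ht
    obtain ⟨hb, hc, hfl⟩ := hbc
    refine ⟨c, hb'.tail ⟨isTiling_congr hb he.symm, hc, ?_⟩, Set.eqOn_refl _ _⟩
    rcases hfl with ⟨p, q, m, hfl⟩ | ⟨p, q, m, hfl⟩
    · exact Or.inl ⟨p, q, m, gdFlipAt_congr hfl he.symm (Set.eqOn_refl _ _)⟩
    · exact Or.inr ⟨p, q, m, gdFlipAt_congr hfl (Set.eqOn_refl _ _) he.symm⟩

/-- Any two tilings with the same hole set `S` are connected by a finite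
sequence of tilings with hole set `S` in which each tiling is obtained from the previous
one by a GD flip or the inverse of a GD flip. -/
theorem tilings_connected_by_gd_flips (n : ℕ) (hn : 0 < n) (S : Finset (ℕ × ℕ))
    (hS : ↑S ⊆ UpTri n) (hcard : S.card = n)
    (f g : ℕ × ℕ → ℕ × ℕ) (hf : IsTiling n ↑S f) (hg : IsTiling n ↑S g) :
    ∃ (m : ℕ) (F : ℕ → ℕ × ℕ → ℕ × ℕ),
      F 0 = f ∧ Set.EqOn (F m) g (DownTri n) ∧
      (∀ k ≤ m, IsTiling n ↑S (F k)) ∧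
      (∀ k < m, GDFlip n (F k) (F (k + 1)) ∨ GDFlip n (F (k + 1)) (F k)) := by
  obtain ⟨t, ht, htt, htn⟩ := reach_terminal n ↑S _ f rfl hf
  obtain ⟨s, hs, hst, hsn⟩ := reach_terminal n ↑S _ g rfl hg
  have he := terminal_unique hst htt hsn htn
  have hs' : Relation.ReflTransGen (FStep n ↑S) s g := by
    clear he hst hsn hg
    induction hs with
    | refl => exact .refl
    | tail _ hbc ih => exact .head hbc.symm ih
  obtain ⟨g', h1, h2⟩ := reach_congr hs' t he
  obtain ⟨m, F, e0, em, hT, hF⟩ := seq_of_reach hf (ht.trans h1)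
  exact ⟨m, F, e0, em ▸ h2, hT, hF⟩
end

section
/- For every spread-out set S of n upward unit triangles, there is exactly one tiling of Δ with hole set S that contains no CW-GD at any (a,b,m). -/
/-- Existence of a run pattern in a periodic 0-1-2 sequence. -/
lemma run_pattern (s : ℕ → ZMod 3) (N : ℕ) (hN : 0 < N) (hper : ∀ t, s (t + N) = s t)
    (hstep : ∀ t, s (t + 1) = s t ∨ s (t + 1) = s t + 1)
    (hch : ∃ t, s (t + 1) ≠ s t) :
    ∃ k q x, 1 ≤ q ∧ (∀ t < q, s (k + t) = x) ∧ (∀ t < q, s (k + q + t) = x + 1) ∧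
      (∀ t < q, s (k + q + q + t) = x + 2) := by
  classical
  have hperm : ∀ c t, s (t + c * N) = s t := by
    intro c
    induction c with
    | zero => intro t; simp
    | succ c ih => intro t; rw [show t + (c + 1) * N = (t + c * N) + N by ring, hper, ih]
  let P : ℕ → Prop := fun q => 1 ≤ q ∧ ∃ k, s (k + 1) ≠ s k ∧
    (∀ t < q, s (k + 1 + t) = s (k + 1)) ∧ s (k + 1 + q) ≠ s (k + 1)
  have hP : ∃ q, P q := by
    obtain ⟨k, hk⟩ := hch
    have h1 : ∃ l, s (k + 1 + l) ≠ s (k + 1) := by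
      refine ⟨N - 1, ?_⟩
      rw [show k + 1 + (N - 1) = k + N by omega, hper]
      exact hk.symm
    refine ⟨Nat.find h1, ?_, k, hk, ?_, Nat.find_spec h1⟩
    · rcases Nat.eq_zero_or_pos (Nat.find h1) with h | h
      · have := Nat.find_spec h1
        rw [h] at this
        exact absurd rfl this
      · exact h
    · intro t ht
      have := Nat.find_min h1 ht
      simpa using this
  obtain ⟨q, ⟨hq1, k0, h0, h1, h2⟩, hmin⟩ : ∃ q, P q ∧ ∀ r < q, ¬ P r :=
    ⟨Nat.find hP, Nat.find_spec hP, fun r hr => Nat.find_min hP hr⟩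
  obtain ⟨k, hkq, h0, h1, h2⟩ : ∃ k, q ≤ k ∧ s (k + 1) ≠ s k ∧
    (∀ t < q, s (k + 1 + t) = s (k + 1)) ∧ s (k + 1 + q) ≠ s (k + 1) := by
    refine ⟨k0 + q * N, ?_, ?_, ?_, ?_⟩
    · nlinarith
    · rw [show k0 + q * N + 1 = k0 + 1 + q * N by ring, hperm, hperm]; exact h0
    · intro t ht
      rw [show k0 + q * N + 1 + t = k0 + 1 + t + q * N by ring,
        show k0 + q * N + 1 = k0 + 1 + q * N by ring, hperm, hperm]; exact h1 t ht
    · rw [show k0 + q * N + 1 + q = k0 + 1 + q + q * N by ring,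
        show k0 + q * N + 1 = k0 + 1 + q * N by ring, hperm, hperm]; exact h2
  have e1 : s (k + 1) = s k + 1 := (hstep k).resolve_left h0
  have e2 : s (k + 1 + q) = s k + 2 := by
    have h3 := h1 (q - 1) (by omega)
    have h4 := hstep (k + 1 + (q - 1))
    rw [show k + 1 + (q - 1) + 1 = k + 1 + q by omega, h3] at h4
    rw [h4.resolve_left h2, e1]; ring
  have back : ∀ t < q, s (k - t) = s k := by
    intro t
    induction t using Nat.strong_induction_on with
    | _ t ih =>
      intro ht
      by_contra hne
      have ht0 : 1 ≤ t := by
        rcases Nat.eq_zero_or_pos t with h | h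
        · subst h; exact absurd rfl hne
        · exact h
      have e3 : s (k - t + 1) = s k := by
        rw [show k - t + 1 = k - (t - 1) by omega]
        exact ih (t - 1) (by omega) (by omega)
      refine hmin t ht ⟨ht0, k - t, ?_, ?_, ?_⟩
      · rw [e3]; exact fun h => hne h.symm
      · intro r hr
        rw [e3, show k - t + 1 + r = k - (t - 1 - r) by omega]
        exact ih _ (by omega) (by omega)
      · rw [e3, show k - t + 1 + t = k + 1 by omega]; exact h0
  have fwd : ∀ t < q, s (k + 1 + q + t) = s k + 2 := by
    intro t
    induction t using Nat.strong_induction_on with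
    | _ t ih =>
      intro ht
      by_contra hne
      have ht0 : 1 ≤ t := by
        rcases Nat.eq_zero_or_pos t with h | h
        · subst h; exact absurd e2 hne
        · exact h
      have e4 : s (k + q) = s (k + 1) := by
        rw [show k + q = k + 1 + (q - 1) by omega]; exact h1 _ (by omega)
      refine hmin t ht ⟨ht0, k + q, ?_, ?_, ?_⟩
      · rw [e4, show k + q + 1 = k + 1 + q by omega]; exact h2
      · intro r hr
        rw [show k + q + 1 = k + 1 + q by omega, e2]
        exact ih r hr (by omega)
      · rw [show k + q + 1 = k + 1 + q by omega, e2]; exact hne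
  refine ⟨k + 1 - q, q, s k, hq1, ?_, ?_, ?_⟩
  · intro t ht
    rw [show k + 1 - q + t = k - (q - 1 - t) by omega]
    exact back _ (by omega)
  · intro t ht
    rw [show k + 1 - q + q + t = k + 1 + t by omega, h1 t ht, e1]
  · intro t ht
    rw [show k + 1 - q + q + q + t = k + 1 + q + t by omega]
    exact fwd t ht

/-- Explicit clockwise ring with side parameter `q = m - 2`. -/
def CWx (f : ℕ × ℕ → ℕ × ℕ) (a b q : ℕ) : Prop :=
  (∀ t < q, f (a, b + t) = (a, b + t + 1)) ∧
  (∀ t < q, f (a + t, b + q - t) = (a + t + 1, b + q - t)) ∧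
  (∀ t < q, f (a + q - t, b) = (a + q - t, b))

lemma ringDown_iff (a b q i j : ℕ) (hq : 1 ≤ q) : (i, j) ∈ RingDown a b (q + 2) ↔
    (i = a ∧ b ≤ j ∧ j < b + q) ∨ (a ≤ i ∧ i < a + q ∧ i + j = a + b + q) ∨
      (j = b ∧ a < i ∧ i ≤ a + q) := by
  simp only [RingDown, DownCells, Set.mem_sdiff, Set.mem_ofPred_eq]
  omega

lemma ringUp_iff (a b q i j : ℕ) (hq : 1 ≤ q) : (i, j) ∈ RingUp a b (q + 2) ↔
    (i = a ∧ b < j ∧ j ≤ b + q) ∨ (a < i ∧ i ≤ a + q ∧ i + j = a + b + q + 1) ∨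
      (j = b ∧ a < i ∧ i ≤ a + q) := by
  simp only [RingUp, UpCells, Set.mem_sdiff, Set.mem_ofPred_eq, Set.mem_union, Set.mem_insert_iff,
    Set.mem_singleton_iff, Prod.mk.injEq]
  omega

lemma CWx.left {f : ℕ × ℕ → ℕ × ℕ} {a b q : ℕ} (h : CWx f a b q) {i j : ℕ}
    (h1 : i = a ∧ b ≤ j ∧ j < b + q) : f (i, j) = (i, j + 1) := by
  have := h.1 (j - b) (by omega)
  rw [show b + (j - b) = j by omega] at this
  rw [h1.1]; exact this

lemma CWx.hyp {f : ℕ × ℕ → ℕ × ℕ} {a b q : ℕ} (h : CWx f a b q) {i j : ℕ}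
    (h1 : a ≤ i ∧ i < a + q ∧ i + j = a + b + q) : f (i, j) = (i + 1, j) := by
  have := h.2.1 (i - a) (by omega)
  rw [show a + (i - a) = i by omega, show b + q - (i - a) = j by omega] at this
  exact this

lemma CWx.bot {f : ℕ × ℕ → ℕ × ℕ} {a b q : ℕ} (h : CWx f a b q) {i j : ℕ}
    (h1 : j = b ∧ a < i ∧ i ≤ a + q) : f (i, j) = (i, j) := by
  have := h.2.2 (a + q - i) (by omega)
  rw [show a + q - (a + q - i) = i by omega] at this
  rw [h1.1]; exact this

lemma CWx.cwgd {f : ℕ × ℕ → ℕ × ℕ} {a b q : ℕ} (hq : 1 ≤ q) (h : CWx f a b q) :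
    CWGD f a b (q + 2) := by
  refine ⟨?_, h.1 0 (by omega)⟩
  ext ⟨i, j⟩
  rw [ringUp_iff _ _ _ _ _ hq]
  constructor
  · rintro ⟨⟨i', j'⟩, hd, he⟩
    rw [ringDown_iff _ _ _ _ _ hq] at hd
    rcases hd with hd | hd | hd
    · rw [h.left hd] at he; simp only [Prod.mk.injEq] at he; omega
    · rw [h.hyp hd] at he; simp only [Prod.mk.injEq] at he; omega
    · rw [h.bot hd] at he; simp only [Prod.mk.injEq] at he; omega
  · rintro (hd | hd | hd)
    · refine ⟨(i, j - 1), (ringDown_iff _ _ _ _ _ hq).2 (by omega), ?_⟩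
      rw [h.left (by omega)]; simp only [Prod.mk.injEq, true_and, and_true]; omega
    · refine ⟨(i - 1, j), (ringDown_iff _ _ _ _ _ hq).2 (by omega), ?_⟩
      rw [h.hyp (by omega)]; simp only [Prod.mk.injEq, true_and, and_true]; omega
    · exact ⟨(i, j), (ringDown_iff _ _ _ _ _ hq).2 (by omega), h.bot hd⟩

lemma cwx_of_cwgd {f : ℕ × ℕ → ℕ × ℕ} {a b q : ℕ} (hq : 1 ≤ q)
    (hinj : Set.InjOn f (RingDown a b (q + 2))) (hadj : ∀ d ∈ RingDown a b (q + 2), Adj d (f d))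
    (h : CWGD f a b (q + 2)) : CWx f a b q := by
  have hmap : ∀ i j, (i, j) ∈ RingDown a b (q + 2) → f (i, j) ∈ RingUp a b (q + 2) :=
    fun i j hd => h.1 ▸ Set.mem_image_of_mem f hd
  have hopt : ∀ i j, (i, j) ∈ RingDown a b (q + 2) →
      f (i, j) = (i, j) ∨ f (i, j) = (i + 1, j) ∨ f (i, j) = (i, j + 1) :=
    fun i j hd => hadj _ hd
  have key : ∀ i j k l, (i, j) ∈ RingDown a b (q + 2) → (k, l) ∈ RingDown a b (q + 2) →
      f (i, j) = f (k, l) → i = k ∧ j = l := by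
    intro i j k l h1 h2 h3
    have := hinj h1 h2 h3
    simpa using this
  simp only [ringDown_iff _ _ _ _ _ hq] at hmap hopt key
  have A : ∀ t < q, f (a, b + t) = (a, b + t + 1) := by
    intro t
    induction t with
    | zero => intro _; exact h.2
    | succ t ih =>
      intro ht
      have p := ih (by omega)
      have hm := hmap a (b + (t + 1)) (by omega)
      rcases hopt a (b + (t + 1)) (by omega) with e | e | e
      · have := key a (b + (t + 1)) a (b + t) (by omega) (by omega) (by rw [e, p]; rfl)
        omega
      · rw [e, ringUp_iff _ _ _ _ _ hq] at hm; omega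
      · exact e
  have B : ∀ t < q, f (a + t, b + q - t) = (a + t + 1, b + q - t) := by
    intro t
    induction t with
    | zero =>
      intro ht
      have p := A (q - 1) (by omega)
      have hm := hmap a (b + q) (by omega)
      rcases hopt a (b + q) (by omega) with e | e | e
      · have := key a (b + q) a (b + (q - 1)) (by omega) (by omega)
          (by rw [e, p]; simp only [Prod.mk.injEq, true_and, and_true]; omega)
        omega
      · exact e
      · rw [e, ringUp_iff _ _ _ _ _ hq] at hm; omega
    | succ t ih =>
      intro ht
      have p := ih (by omega)
      have hm := hmap (a + (t + 1)) (b + q - (t + 1)) (by omega)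
      rcases hopt (a + (t + 1)) (b + q - (t + 1)) (by omega) with e | e | e
      · rw [e, ringUp_iff _ _ _ _ _ hq] at hm; omega
      · exact e
      · have := key (a + (t + 1)) (b + q - (t + 1)) (a + t) (b + q - t) (by omega) (by omega)
          (by rw [e, p]; simp only [Prod.mk.injEq, true_and, and_true]; omega)
        omega
  refine ⟨A, B, ?_⟩
  intro t
  induction t with
  | zero =>
    intro ht
    have p := B (q - 1) (by omega)
    have hm := hmap (a + q) b (by omega)
    rcases hopt (a + q) b (by omega) with e | e | e
    · exact e
    · rw [e, ringUp_iff _ _ _ _ _ hq] at hm; omega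
    · have := key (a + q) b (a + (q - 1)) (b + q - (q - 1)) (by omega) (by omega)
        (by rw [e, p]; simp only [Prod.mk.injEq, true_and, and_true]; omega)
      omega
  | succ t ih =>
    intro ht
    have p := ih (by omega)
    have hm := hmap (a + q - (t + 1)) b (by omega)
    rcases hopt (a + q - (t + 1)) b (by omega) with e | e | e
    · exact e
    · have := key (a + q - (t + 1)) b (a + q - t) b (by omega) (by omega)
        (by rw [e, p]; simp only [Prod.mk.injEq, true_and, and_true]; omega)
      omega
    · rw [e, ringUp_iff _ _ _ _ _ hq] at hm; omega

/-- One step of the right-turning walk. -/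
def WStep (f : ℕ × ℕ → ℕ × ℕ) (d d' : ℕ × ℕ) (c : ZMod 3) : Prop :=
  (c = 0 ∧ f d = (d.1, d.2 + 1) ∧ d'.1 = d.1 ∧ d'.2 = d.2 + 1) ∨
  (c = 1 ∧ f d = (d.1 + 1, d.2) ∧ d'.1 = d.1 + 1 ∧ d'.2 + 1 = d.2) ∨
  (c = 2 ∧ f d = d ∧ d'.1 + 1 = d.1 ∧ d'.2 = d.2)

lemma WStep.of0 {f : ℕ × ℕ → ℕ × ℕ} {d d' : ℕ × ℕ} {c : ZMod 3} (h : WStep f d d' c)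
    (hc : c = 0) : f d = (d.1, d.2 + 1) ∧ d'.1 = d.1 ∧ d'.2 = d.2 + 1 := by
  rcases h with h | h | h
  · exact h.2
  · exact absurd (h.1.symm.trans hc) (by decide)
  · exact absurd (h.1.symm.trans hc) (by decide)

lemma WStep.of1 {f : ℕ × ℕ → ℕ × ℕ} {d d' : ℕ × ℕ} {c : ZMod 3} (h : WStep f d d' c)
    (hc : c = 1) : f d = (d.1 + 1, d.2) ∧ d'.1 = d.1 + 1 ∧ d'.2 + 1 = d.2 := by
  rcases h with h | h | h
  · exact absurd (h.1.symm.trans hc) (by decide)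
  · exact h.2
  · exact absurd (h.1.symm.trans hc) (by decide)

lemma WStep.of2 {f : ℕ × ℕ → ℕ × ℕ} {d d' : ℕ × ℕ} {c : ZMod 3} (h : WStep f d d' c)
    (hc : c = 2) : f d = d ∧ d'.1 + 1 = d.1 ∧ d'.2 = d.2 := by
  rcases h with h | h | h
  · exact absurd (h.1.symm.trans hc) (by decide)
  · exact absurd (h.1.symm.trans hc) (by decide)
  · exact h.2

section Walk
variable {f : ℕ × ℕ → ℕ × ℕ} {D : ℕ → ℕ × ℕ} {s : ℕ → ZMod 3}

lemma run0 (hD : ∀ t, WStep f (D t) (D (t + 1)) (s t)) (k q : ℕ)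
    (h : ∀ t < q, s (k + t) = 0) :
    (∀ t ≤ q, (D (k + t)).1 = (D k).1 ∧ (D (k + t)).2 = (D k).2 + t) ∧
    ∀ t < q, f ((D k).1, (D k).2 + t) = ((D k).1, (D k).2 + t + 1) := by
  have h1 : ∀ t ≤ q, (D (k + t)).1 = (D k).1 ∧ (D (k + t)).2 = (D k).2 + t := by
    intro t
    induction t with
    | zero => intro _; simp
    | succ t ih =>
      intro ht
      have := ih (by omega)
      have h2 := (hD (k + t)).of0 (h t (by omega))
      rw [show k + (t + 1) = k + t + 1 by omega]
      omega
  refine ⟨h1, fun t ht => ?_⟩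
  have h2 := (hD (k + t)).of0 (h t (by omega))
  have h3 := h1 t ht.le
  have h4 : D (k + t) = ((D k).1, (D k).2 + t) := Prod.ext h3.1 h3.2
  rw [h4] at h2
  exact h2.1

lemma run1 (hD : ∀ t, WStep f (D t) (D (t + 1)) (s t)) (k q : ℕ)
    (h : ∀ t < q, s (k + t) = 1) :
    (∀ t ≤ q, (D (k + t)).1 = (D k).1 + t ∧ (D (k + t)).2 + t = (D k).2) ∧
    ∀ t < q, f ((D k).1 + t, (D k).2 - t) = ((D k).1 + t + 1, (D k).2 - t) := by
  have h1 : ∀ t ≤ q, (D (k + t)).1 = (D k).1 + t ∧ (D (k + t)).2 + t = (D k).2 := by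
    intro t
    induction t with
    | zero => intro _; simp
    | succ t ih =>
      intro ht
      have := ih (by omega)
      have h2 := (hD (k + t)).of1 (h t (by omega))
      rw [show k + (t + 1) = k + t + 1 by omega]
      omega
  refine ⟨h1, fun t ht => ?_⟩
  have h2 := (hD (k + t)).of1 (h t (by omega))
  have h3 := h1 t ht.le
  have h4 : D (k + t) = ((D k).1 + t, (D k).2 - t) := Prod.ext h3.1 (by simp only; omega)
  rw [h4] at h2
  exact h2.1

lemma run2 (hD : ∀ t, WStep f (D t) (D (t + 1)) (s t)) (k q : ℕ)
    (h : ∀ t < q, s (k + t) = 2) :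
    (∀ t ≤ q, (D (k + t)).1 + t = (D k).1 ∧ (D (k + t)).2 = (D k).2) ∧
    ∀ t < q, f ((D k).1 - t, (D k).2) = ((D k).1 - t, (D k).2) := by
  have h1 : ∀ t ≤ q, (D (k + t)).1 + t = (D k).1 ∧ (D (k + t)).2 = (D k).2 := by
    intro t
    induction t with
    | zero => intro _; simp
    | succ t ih =>
      intro ht
      have := ih (by omega)
      have h2 := (hD (k + t)).of2 (h t (by omega))
      rw [show k + (t + 1) = k + t + 1 by omega]
      omega
  refine ⟨h1, fun t ht => ?_⟩
  have h2 := (hD (k + t)).of2 (h t (by omega))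
  have h3 := h1 t ht.le
  have h4 : D (k + t) = ((D k).1 - t, (D k).2) := Prod.ext (by simp only; omega) h3.2
  rw [h4] at h2
  exact h2.1

lemma walk_gives_cwx (n : ℕ) (hinj : Set.InjOn f (DownTri n)) (hDn : ∀ t, D t ∈ DownTri n)
    (hD : ∀ t, WStep f (D t) (D (t + 1)) (s t)) (N : ℕ) (hN : 0 < N)
    (hper : ∀ t, D (t + N) = D t) (hsper : ∀ t, s (t + N) = s t) :
    ∃ a b q, 1 ≤ q ∧ a + b + (q + 2) ≤ n ∧ CWx f a b q := by
  have hne : ∀ t, f (D (t + 1)) ≠ f (D t) := by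
    intro t h
    have h1 := hinj (hDn _) (hDn _) h
    rcases hD t with h2 | h2 | h2 <;> rw [h1] at h2 <;> omega
  have hstep : ∀ t, s (t + 1) = s t ∨ s (t + 1) = s t + 1 := by
    intro t
    have h0 := hne t
    have hA := hD t
    have hB := hD (t + 1)
    rcases hA with ⟨c1, f1, p1, p2⟩ | ⟨c1, f1, p1, p2⟩ | ⟨c1, f1, p1, p2⟩ <;>
    rcases hB with ⟨c2, f2, r1, r2⟩ | ⟨c2, f2, r1, r2⟩ | ⟨c2, f2, r1, r2⟩ <;>
    rw [c1, c2] <;> first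
    | (left; decide)
    | (right; decide)
    | (exfalso; apply h0; rw [f1, f2]; apply Prod.ext <;> simp only <;> omega)
  have hch : ∃ t, s (t + 1) ≠ s t := by
    by_contra hcon
    push Not at hcon
    have hc : ∀ t, s t = s 0 := by
      intro t
      induction t with
      | zero => rfl
      | succ t ih => rw [hcon, ih]
    have hp := hper 0
    have h3 : s 0 = 0 ∨ s 0 = 1 ∨ s 0 = 2 := by
      generalize s 0 = x
      revert x; decide
    rcases h3 with h3 | h3 | h3
    · have := (run0 hD 0 N (fun t _ => (hc _).trans h3)).1 N le_rfl
      rw [hp] at this; omega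
    · have := (run1 hD 0 N (fun t _ => (hc _).trans h3)).1 N le_rfl
      rw [hp] at this; omega
    · have := (run2 hD 0 N (fun t _ => (hc _).trans h3)).1 N le_rfl
      rw [hp] at this; omega
  obtain ⟨k, q, x, hq, h1, h2, h3⟩ := run_pattern s N hN hsper hstep hch
  have hx : x = 0 ∨ x = 1 ∨ x = 2 := by clear h1 h2 h3; revert x; decide
  rcases hx with rfl | rfl | rfl
  · obtain ⟨a1, a2⟩ := run0 hD k q h1
    obtain ⟨b1, b2⟩ := run1 hD (k + q) q (fun t ht => (h2 t ht).trans (by decide))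
    obtain ⟨c1, c2⟩ := run2 hD (k + q + q) q (fun t ht => (h3 t ht).trans (by decide))
    have e1 := a1 q le_rfl
    have e2 := b1 q le_rfl
    have m := hDn (k + q)
    simp only [DownTri, Set.mem_ofPred_eq] at m
    refine ⟨(D k).1, (D k).2, q, hq, by omega, a2, ?_, ?_⟩
    · rw [e1.1, e1.2] at b2; exact b2
    · rw [show (D (k + q + q)).1 = (D k).1 + q by omega,
        show (D (k + q + q)).2 = (D k).2 by omega] at c2
      exact c2
  · obtain ⟨a1, a2⟩ := run1 hD k q h1
    obtain ⟨b1, b2⟩ := run2 hD (k + q) q (fun t ht => (h2 t ht).trans (by decide))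
    obtain ⟨c1, c2⟩ := run0 hD (k + q + q) q (fun t ht => (h3 t ht).trans (by decide))
    have e1 := a1 q le_rfl
    have e2 := b1 q le_rfl
    have m := hDn k
    simp only [DownTri, Set.mem_ofPred_eq] at m
    refine ⟨(D k).1, (D (k + q)).2, q, hq, by omega, ?_, ?_, ?_⟩
    · rw [show (D (k + q + q)).1 = (D k).1 by omega, e2.2] at c2
      exact c2
    · rw [← e1.2] at a2; exact a2
    · rw [e1.1] at b2
      exact b2
  · obtain ⟨a1, a2⟩ := run2 hD k q h1
    obtain ⟨b1, b2⟩ := run0 hD (k + q) q (fun t ht => (h2 t ht).trans (by decide))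
    obtain ⟨c1, c2⟩ := run1 hD (k + q + q) q (fun t ht => (h3 t ht).trans (by decide))
    have e1 := a1 q le_rfl
    have e2 := b1 q le_rfl
    have m := hDn k
    simp only [DownTri, Set.mem_ofPred_eq] at m
    refine ⟨(D (k + q)).1, (D k).2, q, hq, by omega, ?_, ?_, ?_⟩
    · rw [e1.2] at b2
      exact b2
    · rw [e2.1, e2.2, e1.2] at c2; exact c2
    · rw [← e1.1] at a2
      exact a2

end Walk

lemma downTri_finite (n : ℕ) : (DownTri n).Finite := by
  apply Set.Finite.subset ((Set.finite_Iio n).prod (Set.finite_Iio n))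
  rintro ⟨i, j⟩ h
  simp only [DownTri, Set.mem_ofPred_eq] at h
  simp only [Set.mem_prod, Set.mem_Iio]
  omega

lemma trap {f : ℕ × ℕ → ℕ × ℕ} (n : ℕ) (hinj : Set.InjOn f (DownTri n)) (X : Set (ℕ × ℕ))
    (hX : X ⊆ DownTri n) (d0 : ℕ × ℕ) (hd0 : d0 ∈ X)
    (hstep : ∀ d ∈ X, ∃ d' ∈ X, ∃ c, WStep f d d' c) :
    ∃ a b m, 3 ≤ m ∧ a + b + m ≤ n ∧ CWGD f a b m := by
  have h' : ∀ d : X, ∃ d' : X, ∃ c, WStep f d d' c := by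
    rintro ⟨d, hd⟩
    obtain ⟨d', hd', c, hc⟩ := hstep d hd
    exact ⟨⟨d', hd'⟩, c, hc⟩
  choose r c hr using h'
  have : Finite X := ((downTri_finite n).subset hX).to_subtype
  obtain ⟨i, j, hij, he⟩ : ∃ i j, i < j ∧ r^[i] ⟨d0, hd0⟩ = r^[j] ⟨d0, hd0⟩ := by
    obtain ⟨i, j, hne, he⟩ := Finite.exists_ne_map_eq_of_infinite (fun t : ℕ => r^[t] ⟨d0, hd0⟩)
    rcases lt_or_gt_of_ne hne with h | h
    · exact ⟨i, j, h, he⟩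
    · exact ⟨j, i, h, he.symm⟩
  let E : ℕ → X := fun t => r^[t + i] ⟨d0, hd0⟩
  have hper : ∀ t, E (t + (j - i)) = E t := by
    intro t
    change r^[t + (j - i) + i] _ = r^[t + i] _
    rw [show t + (j - i) + i = t + j by omega, Function.iterate_add_apply, ← he,
      ← Function.iterate_add_apply]
  obtain ⟨a, b, q, hq, hn, hc⟩ := walk_gives_cwx (f := f) (D := fun t => (E t : ℕ × ℕ))
    (s := fun t => c (E t)) n hinj (fun t => hX (E t).2)
    (by
      intro t
      have := hr (E t)
      have h2 : r (E t) = E (t + 1) := by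
        change r (r^[t + i] _) = r^[t + 1 + i] _
        rw [show t + 1 + i = (t + i) + 1 by omega, Function.iterate_succ_apply']
      rw [h2] at this
      exact this) (j - i) (by omega) (fun t => by simp only [hper]) (fun t => by simp only [hper])
  exact ⟨a, b, q + 2, by omega, hn, hc.cwgd hq⟩

/-- Indicator that the down cell `d` of Δ is matched to `u`. -/
def EInd (n : ℕ) (f : ℕ × ℕ → ℕ × ℕ) (d u : ℕ × ℕ) : ℤ :=
  if d.1 + d.2 + 2 ≤ n ∧ f d = u then 1 else 0

lemma eInd_nonneg (n : ℕ) (f : ℕ × ℕ → ℕ × ℕ) (d u : ℕ × ℕ) : 0 ≤ EInd n f d u := by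
  unfold EInd; split_ifs <;> simp

lemma eInd_le (n : ℕ) (f : ℕ × ℕ → ℕ × ℕ) (d u : ℕ × ℕ) : EInd n f d u ≤ 1 := by
  unfold EInd; split_ifs <;> simp

lemma eInd_eq_one {n : ℕ} {f : ℕ × ℕ → ℕ × ℕ} {d u : ℕ × ℕ} (h : d.1 + d.2 + 2 ≤ n)
    (h2 : f d = u) : EInd n f d u = 1 := by
  unfold EInd; rw [if_pos ⟨h, h2⟩]

lemma eInd_eq_zero {n : ℕ} {f : ℕ × ℕ → ℕ × ℕ} {d u : ℕ × ℕ}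
    (h : d.1 + d.2 + 2 ≤ n → f d ≠ u) : EInd n f d u = 0 := by
  unfold EInd; rw [if_neg (fun hh => h hh.1 hh.2)]

lemma down_sum {n : ℕ} {S : Set (ℕ × ℕ)} {f : ℕ × ℕ → ℕ × ℕ} (hf : IsTiling n S f) (i j : ℕ) :
    EInd n f (i, j) (i, j) + EInd n f (i, j) (i + 1, j) + EInd n f (i, j) (i, j + 1) =
      if i + j + 2 ≤ n then 1 else 0 := by
  split_ifs with h
  · rcases hf.2 (i, j) h with e | e | e <;> simp [EInd, e, h]
  · simp [EInd, h]

open Classical in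
lemma up_sum {n : ℕ} {S : Set (ℕ × ℕ)} {f : ℕ × ℕ → ℕ × ℕ} (hf : IsTiling n S f) (i j : ℕ) :
    EInd n f (i, j) (i, j) + (if 0 < i then EInd n f (i - 1, j) (i, j) else 0) +
      (if 0 < j then EInd n f (i, j - 1) (i, j) else 0) =
      if (i, j) ∈ UpTri n \ S then 1 else 0 := by
  have hz : ∀ d d' u : ℕ × ℕ, d' ∈ DownTri n → f d' = u → d ≠ d' → EInd n f d u = 0 := by
    intro d d' u hd' he hne
    apply eInd_eq_zero
    intro hd h2
    exact hne (hf.1.injOn hd hd' (h2.trans he.symm))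
  split_ifs with h h1 h2 h3 h4 h5
  all_goals first
  | (obtain ⟨⟨p, q⟩, hd, he⟩ := hf.1.surjOn (by assumption)
     have ha := hf.2 _ hd
     rw [he] at ha
     have hd' : p + q + 2 ≤ n := hd
     simp only [Adj, Prod.mk.injEq] at ha
     rcases ha with ⟨rfl, rfl⟩ | ⟨rfl, rfl⟩ | ⟨rfl, rfl⟩
     · first
       | omega
       | (rw [eInd_eq_one (d := (i, j)) (u := (i, j)) hd he]
          try rw [hz (i - 1, j) _ _ hd he (by simp only [ne_eq, Prod.mk.injEq]; omega)]
          try rw [hz (i, j - 1) _ _ hd he (by simp only [ne_eq, Prod.mk.injEq]; omega)]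
          simp)
     · first
       | omega
       | (rw [hz (p + 1, j) _ _ hd he (by simp only [ne_eq, Prod.mk.injEq]; omega)]
          try rw [hz (p + 1, j - 1) _ _ hd he (by simp only [ne_eq, Prod.mk.injEq]; omega)]
          rw [show p + 1 - 1 = p from rfl, eInd_eq_one (d := (p, j)) (u := (p + 1, j)) hd he]
          simp)
     · first
       | omega
       | (rw [hz (i, q + 1) _ _ hd he (by simp only [ne_eq, Prod.mk.injEq]; omega)]
          try rw [hz (i - 1, q + 1) _ _ hd he (by simp only [ne_eq, Prod.mk.injEq]; omega)]
          rw [show q + 1 - 1 = q from rfl, eInd_eq_one (d := (i, q)) (u := (i, q + 1)) hd he]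
          simp))
  | (have hzz : ∀ d, EInd n f d (i, j) = 0 := by
       intro d
       apply eInd_eq_zero
       intro hd h2
       have := hf.1.mapsTo (show d ∈ DownTri n from hd)
       rw [h2] at this
       contradiction
     simp only [hzz]; simp)

/-- Difference of indicators of two tilings. -/
def XD (n : ℕ) (f g : ℕ × ℕ → ℕ × ℕ) (d u : ℕ × ℕ) : ℤ := EInd n f d u - EInd n g d u

/-- Increments of the height difference. -/
def YD (n : ℕ) (f g : ℕ × ℕ → ℕ × ℕ) (i j : ℕ) : ℤ :=
  if 0 < j then XD n f g (i, j - 1) (i, j) else 0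

/-- Height difference. -/
def HD (n : ℕ) (f g : ℕ × ℕ → ℕ × ℕ) (p q : ℕ) : ℤ := ∑ i ∈ Finset.range p, YD n f g i q

section Height
variable {n : ℕ} {S : Set (ℕ × ℕ)} {f g : ℕ × ℕ → ℕ × ℕ}

lemma xd_down (hf : IsTiling n S f) (hg : IsTiling n S g) (i j : ℕ) :
    XD n f g (i, j) (i, j) + XD n f g (i, j) (i + 1, j) + XD n f g (i, j) (i, j + 1) = 0 := by
  have h1 := down_sum hf i j
  have h2 := down_sum hg i j
  unfold XD
  linarith

lemma xd_up (hf : IsTiling n S f) (hg : IsTiling n S g) (i j : ℕ) :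
    XD n f g (i, j) (i, j) + (if 0 < i then XD n f g (i - 1, j) (i, j) else 0) +
      YD n f g i j = 0 := by
  have h1 := up_sum hf i j
  have h2 := up_sum hg i j
  unfold YD XD
  rw [← h2] at h1
  split_ifs at * <;> linarith

lemma xd_out {d u : ℕ × ℕ} (h : ¬ d.1 + d.2 + 2 ≤ n) : XD n f g d u = 0 := by
  simp [XD, EInd, h]

lemma hd_r2 (i j : ℕ) :
    HD n f g (i + 1) (j + 1) - HD n f g i (j + 1) = XD n f g (i, j) (i, j + 1) := by
  unfold HD
  rw [Finset.sum_range_succ]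
  simp [YD]

lemma hd_r1 (hf : IsTiling n S f) (hg : IsTiling n S g) (i j : ℕ) :
    HD n f g (i + 1) j - HD n f g (i + 1) (j + 1) = XD n f g (i, j) (i + 1, j) := by
  induction i with
  | zero =>
    have h1 := xd_down hf hg 0 j
    have h2 := xd_up hf hg 0 j
    simp only [HD, zero_add, Finset.sum_range_one, lt_irrefl, if_false] at *
    have h3 : YD n f g 0 (j + 1) = XD n f g (0, j) (0, j + 1) := by simp [YD]
    linarith
  | succ i ih =>
    have h1 := xd_down hf hg (i + 1) j
    have h2 := xd_up hf hg (i + 1) j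
    have h3 : YD n f g (i + 1) (j + 1) = XD n f g (i + 1, j) (i + 1, j + 1) := by simp [YD]
    have h4 : HD n f g (i + 1 + 1) j = HD n f g (i + 1) j + YD n f g (i + 1) j :=
      Finset.sum_range_succ _ _
    have h5 : HD n f g (i + 1 + 1) (j + 1) = HD n f g (i + 1) (j + 1) + YD n f g (i + 1) (j + 1) :=
      Finset.sum_range_succ _ _
    rw [if_pos (Nat.succ_pos i), show i + 1 - 1 = i from rfl] at h2
    linarith

lemma hd_r0 (hf : IsTiling n S f) (hg : IsTiling n S g) (i j : ℕ) :
    HD n f g i (j + 1) - HD n f g (i + 1) j = XD n f g (i, j) (i, j) := by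
  have h1 := xd_down hf hg i j
  have h2 := hd_r1 hf hg i j
  have h3 := hd_r2 (n := n) (f := f) (g := g) i j
  linarith

lemma hd_zero_left (q : ℕ) : HD n f g 0 q = 0 := by simp [HD]

lemma hd_zero_bot (p : ℕ) : HD n f g p 0 = 0 := by simp [HD, YD]

lemma hd_zero_out (hf : IsTiling n S f) (hg : IsTiling n S g) (p q : ℕ) (h : n ≤ p + q) :
    HD n f g p q = 0 := by
  induction q generalizing p with
  | zero => exact hd_zero_bot p
  | succ q ih =>
    have h1 := hd_r0 hf hg p q
    rw [xd_out (by simp only; omega), ih (p + 1) (by omega)] at h1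
    linarith

lemma hd_interior (hf : IsTiling n S f) (hg : IsTiling n S g) {p q : ℕ}
    (h : 0 < HD n f g p q) : 0 < p ∧ 0 < q ∧ p + q < n := by
  refine ⟨?_, ?_, ?_⟩
  · rcases Nat.eq_zero_or_pos p with h1 | h1
    · rw [h1, hd_zero_left] at h; omega
    · exact h1
  · rcases Nat.eq_zero_or_pos q with h1 | h1
    · rw [h1, hd_zero_bot] at h; omega
    · exact h1
  · by_contra h1
    rw [hd_zero_out hf hg p q (by omega)] at h; omega

lemma cwgd_of_hd_pos (hf : IsTiling n S f) (hg : IsTiling n S g) (p0 q0 : ℕ)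
    (h : 0 < HD n f g p0 q0) : ∃ a b m, 3 ≤ m ∧ a + b + m ≤ n ∧ CWGD f a b m := by
  obtain ⟨⟨p, q⟩, hm, hmax⟩ := Finset.exists_max_image
    (Finset.range (n + 1) ×ˢ Finset.range (n + 1)) (fun v => HD n f g v.1 v.2)
    ⟨(0, 0), by simp⟩
  have hin := hd_interior hf hg h
  have hpos : 0 < HD n f g p q := lt_of_lt_of_le h
    (hmax (p0, q0) (by simp only [Finset.mem_product, Finset.mem_range]; omega))
  have hM : ∀ x y, HD n f g x y ≤ HD n f g p q := by
    intro x y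
    by_cases hx : 0 < HD n f g x y
    · have := hd_interior hf hg hx
      exact hmax (x, y) (by simp only [Finset.mem_product, Finset.mem_range]; omega)
    · linarith
  have hin2 := hd_interior hf hg hpos
  obtain ⟨M, hMe⟩ : ∃ M, M = HD n f g p q := ⟨_, rfl⟩
  rw [← hMe] at hM hpos
  have hinner : ∀ x y, HD n f g x y = M → 0 < x ∧ 0 < y ∧ x + y < n :=
    fun x y hxy => hd_interior hf hg (by rw [hxy]; exact hpos)
  refine trap n hf.1.injOn {d | d ∈ DownTri n ∧ (HD n f g d.1 (d.2 + 1) = M ∨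
    HD n f g (d.1 + 1) (d.2 + 1) = M ∨ HD n f g (d.1 + 1) d.2 = M)} (fun d hd => hd.1)
    (p - 1, q - 1) ?_ ?_
  · refine ⟨?_, Or.inr (Or.inl ?_)⟩
    · simp only [DownTri, Set.mem_ofPred_eq]; omega
    · simp only
      rw [show p - 1 + 1 = p by omega, show q - 1 + 1 = q by omega, hMe]
  · rintro ⟨i, j⟩ ⟨hd, hv⟩
    simp only at hv
    have r0 := hd_r0 hf hg i j
    have r1 := hd_r1 hf hg i j
    have r2 := hd_r2 (n := n) (f := f) (g := g) i j
    have m1 := hM i (j + 1)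
    have m2 := hM (i + 1) (j + 1)
    have m3 := hM (i + 1) j
    have g0 := eInd_nonneg n g (i, j) (i, j)
    have g1 := eInd_nonneg n g (i, j) (i + 1, j)
    have g2 := eInd_nonneg n g (i, j) (i, j + 1)
    have g0' := eInd_le n g (i, j) (i, j)
    have g1' := eInd_le n g (i, j) (i + 1, j)
    have g2' := eInd_le n g (i, j) (i, j + 1)
    have hs := down_sum hf i j
    rw [if_pos (show i + j + 2 ≤ n from hd)] at hs
    unfold XD at r0 r1 r2
    rcases hf.2 (i, j) hd with e | e | e
    · have f0 := eInd_eq_one (n := n) (d := (i, j)) hd e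
      have f1 := eInd_nonneg n f (i, j) (i + 1, j)
      have f2 := eInd_nonneg n f (i, j) (i, j + 1)
      have hv2 : HD n f g i (j + 1) = M := by omega
      have := hinner _ _ hv2
      refine ⟨(i - 1, j), ⟨?_, Or.inr (Or.inl ?_)⟩, 2, Or.inr (Or.inr ⟨rfl, e, ?_, rfl⟩)⟩
      · simp only [DownTri, Set.mem_ofPred_eq]; omega
      · simp only
        rw [show i - 1 + 1 = i by omega]; exact hv2
      · simp only; omega
    · have f1 := eInd_eq_one (n := n) (d := (i, j)) hd e
      have f0 := eInd_nonneg n f (i, j) (i, j)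
      have f2 := eInd_nonneg n f (i, j) (i, j + 1)
      simp only at f1
      have hv2 : HD n f g (i + 1) j = M := by omega
      have := hinner _ _ hv2
      refine ⟨(i + 1, j - 1), ⟨?_, Or.inl ?_⟩, 1, Or.inr (Or.inl ⟨rfl, e, rfl, ?_⟩)⟩
      · simp only [DownTri, Set.mem_ofPred_eq]; omega
      · simp only
        rw [show j - 1 + 1 = j by omega]; exact hv2
      · simp only; omega
    · have f2 := eInd_eq_one (n := n) (d := (i, j)) hd e
      have f0 := eInd_nonneg n f (i, j) (i, j)
      have f1 := eInd_nonneg n f (i, j) (i + 1, j)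
      simp only at f2
      have hv2 : HD n f g (i + 1) (j + 1) = M := by omega
      have := hinner _ _ hv2
      refine ⟨(i, j + 1), ⟨?_, Or.inr (Or.inr hv2)⟩, 0, Or.inl ⟨rfl, e, rfl, rfl⟩⟩
      simp only [DownTri, Set.mem_ofPred_eq]; omega

lemma hd_swap (p q : ℕ) : HD n g f p q = - HD n f g p q := by
  unfold HD
  rw [← Finset.sum_neg_distrib]
  refine Finset.sum_congr rfl fun i _ => ?_
  unfold YD XD
  split_ifs <;> ring

lemma eqOn_of_no_cwgd (hf : IsTiling n S f) (hg : IsTiling n S g)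
    (cf : ∀ a b m : ℕ, 3 ≤ m → a + b + m ≤ n → ¬ CWGD f a b m)
    (cg : ∀ a b m : ℕ, 3 ≤ m → a + b + m ≤ n → ¬ CWGD g a b m) :
    Set.EqOn g f (DownTri n) := by
  have hH : ∀ p q, HD n f g p q = 0 := by
    intro p q
    rcases lt_trichotomy (HD n f g p q) 0 with h | h | h
    · obtain ⟨a, b, m, h1, h2, h3⟩ := cwgd_of_hd_pos hg hf p q (by rw [hd_swap]; omega)
      exact absurd h3 (cg a b m h1 h2)
    · exact h
    · obtain ⟨a, b, m, h1, h2, h3⟩ := cwgd_of_hd_pos hf hg p q h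
      exact absurd h3 (cf a b m h1 h2)
  rintro ⟨i, j⟩ hd
  have key : ∀ u, XD n f g (i, j) u = 0 → f (i, j) = u → g (i, j) = u := by
    intro u hx hu
    have h1 := eInd_eq_one (n := n) (d := (i, j)) hd hu
    by_contra hne
    have h2 : EInd n g (i, j) u = 0 := eInd_eq_zero (fun _ => hne)
    unfold XD at hx
    omega
  have r0 := hd_r0 hf hg i j
  have r1 := hd_r1 hf hg i j
  have r2 := hd_r2 (n := n) (f := f) (g := g) i j
  simp only [hH, sub_zero] at r0 r1 r2
  rcases hf.2 (i, j) hd with e | e | e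
  · rw [e]; exact key _ r0.symm e
  · rw [e]; exact key _ r1.symm e
  · rw [e]; exact key _ r2.symm e

end Height

/-- Upward cells of `T(a,b,k)` as a finset. -/
def UF (a b k : ℕ) : Finset (ℕ × ℕ) :=
  (Finset.range (a + b + k) ×ˢ Finset.range (a + b + k)).filter
    (fun p => a ≤ p.1 ∧ b ≤ p.2 ∧ p.1 + p.2 + 1 ≤ a + b + k)

/-- Downward cells of `T(a,b,k)` as a finset. -/
def DF (a b k : ℕ) : Finset (ℕ × ℕ) :=
  (Finset.range (a + b + k) ×ˢ Finset.range (a + b + k)).filter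
    (fun p => a ≤ p.1 ∧ b ≤ p.2 ∧ p.1 + p.2 + 2 ≤ a + b + k)

lemma mem_UF {a b k i j : ℕ} : (i, j) ∈ UF a b k ↔ a ≤ i ∧ b ≤ j ∧ i + j + 1 ≤ a + b + k := by
  simp only [UF, Finset.mem_filter, Finset.mem_product, Finset.mem_range]; omega

lemma mem_DF {a b k i j : ℕ} : (i, j) ∈ DF a b k ↔ a ≤ i ∧ b ≤ j ∧ i + j + 2 ≤ a + b + k := by
  simp only [DF, Finset.mem_filter, Finset.mem_product, Finset.mem_range]; omega

lemma card_UF (a b k : ℕ) : (UF a b k).card = (DF a b k).card + k := by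
  have h1 : UF a b k = DF a b k ∪ (Finset.range k).image (fun t => (a + t, b + k - 1 - t)) := by
    ext ⟨i, j⟩
    simp only [Finset.mem_union, mem_UF, mem_DF, Finset.mem_image, Finset.mem_range,
      Prod.mk.injEq]
    constructor
    · intro h
      by_cases h2 : i + j + 2 ≤ a + b + k
      · left; omega
      · right; exact ⟨i - a, by omega, by omega, by omega⟩
    · rintro (h | ⟨t, h1, h2, h3⟩) <;> omega
  rw [h1, Finset.card_union_of_disjoint, Finset.card_image_of_injective, Finset.card_range]
  · intro x y h
    simp only [Prod.mk.injEq] at h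
    omega
  · rw [Finset.disjoint_left]
    rintro ⟨i, j⟩ h
    simp only [mem_DF, Finset.mem_image, Finset.mem_range, Prod.mk.injEq] at *
    rintro ⟨t, h1, h2, h3⟩
    omega

/-- Neighbours of a downward cell. -/
def Nb (d : ℕ × ℕ) : Finset (ℕ × ℕ) := {d, (d.1 + 1, d.2), (d.1, d.2 + 1)}

/-- Neighbours of a set of downward cells. -/
def NB (A : Finset (ℕ × ℕ)) : Finset (ℕ × ℕ) := A.biUnion Nb

lemma mem_Nb {d u : ℕ × ℕ} : u ∈ Nb d ↔ Adj d u := by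
  simp [Nb, Adj]

lemma mem_Nb' {i j k l : ℕ} : (k, l) ∈ Nb (i, j) ↔
    (k = i ∧ l = j) ∨ (k = i + 1 ∧ l = j) ∨ (k = i ∧ l = j + 1) := by
  simp [Nb]

lemma mem_NB {A : Finset (ℕ × ℕ)} {u : ℕ × ℕ} : u ∈ NB A ↔ ∃ d ∈ A, u ∈ Nb d := by
  simp [NB]

lemma mem_NB_of {A : Finset (ℕ × ℕ)} {i j k l : ℕ} (h : (i, j) ∈ A)
    (h2 : (k = i ∧ l = j) ∨ (k = i + 1 ∧ l = j) ∨ (k = i ∧ l = j + 1)) : (k, l) ∈ NB A :=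
  mem_NB.2 ⟨_, h, mem_Nb'.2 h2⟩

/-- `A` is closed: any down cell with two neighbours in `NB A` is in `A`. -/
def ClosedD (n : ℕ) (A : Finset (ℕ × ℕ)) : Prop :=
  ∀ d ∈ DF 0 0 n, ∀ u ∈ Nb d, ∀ v ∈ Nb d, u ≠ v → u ∈ NB A → v ∈ NB A → d ∈ A

lemma interval_prop (R : ℕ → Prop) (lo hi p0 : ℕ)
    (hup : ∀ p, lo ≤ p → p + 1 ≤ hi → R p → R (p + 1))
    (hdn : ∀ p, lo ≤ p → p + 1 ≤ hi → R (p + 1) → R p)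
    (h1 : lo ≤ p0) (h2 : p0 ≤ hi) (h0 : R p0) : ∀ p, lo ≤ p → p ≤ hi → R p := by
  have up : ∀ t, p0 + t ≤ hi → R (p0 + t) := by
    intro t
    induction t with
    | zero => intro _; exact h0
    | succ t ih => intro ht; exact hup (p0 + t) (by omega) (by omega) (ih (by omega))
  have dn : ∀ t, lo + t ≤ p0 → R (p0 - t) := by
    intro t
    induction t with
    | zero => intro _; exact h0
    | succ t ih =>
      intro ht
      apply hdn (p0 - (t + 1)) (by omega) (by omega)
      rw [show p0 - (t + 1) + 1 = p0 - t by omega]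
      exact ih (by omega)
  intro p hp1 hp2
  rcases le_total p p0 with h | h
  · have := dn (p0 - p) (by omega)
    rwa [show p0 - (p0 - p) = p by omega] at this
  · have := up (p - p0) (by omega)
    rwa [show p0 + (p - p0) = p by omega] at this

lemma UF_subset_NB {A : Finset (ℕ × ℕ)} {a b k : ℕ} (hk : 2 ≤ k) (h : DF a b k ⊆ A) :
    UF a b k ⊆ NB A := by
  rintro ⟨i, j⟩ hu
  rw [mem_UF] at hu
  by_cases h1 : i + j + 2 ≤ a + b + k
  · exact mem_NB_of (h (mem_DF.2 (show a ≤ i ∧ b ≤ j ∧ _ by omega))) (by omega)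
  · by_cases h2 : a < i
    · exact mem_NB_of (i := i - 1) (j := j) (h (mem_DF.2 (by omega))) (by omega)
    · exact mem_NB_of (i := i) (j := j - 1) (h (mem_DF.2 (by omega))) (by omega)

lemma maximal_disjoint {n : ℕ} {A : Finset (ℕ × ℕ)} (hA : A ⊆ DF 0 0 n) (hc : ClosedD n A)
    {a b k : ℕ} (hk : 2 ≤ k) (hn : a + b + k ≤ n) (hT : DF a b k ⊆ A)
    (hmax : ∀ a' b', a' + b' + (k + 1) ≤ n → DF a b k ⊆ DF a' b' (k + 1) →
      ¬ DF a' b' (k + 1) ⊆ A)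
    (d : ℕ × ℕ) (hd : d ∈ A) (hdT : d ∉ DF a b k) (u : ℕ × ℕ) (hu : u ∈ Nb d) :
    u ∉ UF a b k := by
  intro huT
  have hUN := UF_subset_NB hk hT
  have cl : ∀ i j k1 l1 k2 l2, i + j + 2 ≤ n → (k1, l1) ∈ Nb (i, j) → (k2, l2) ∈ Nb (i, j) →
      ¬ (k1 = k2 ∧ l1 = l2) → (k1, l1) ∈ NB A → (k2, l2) ∈ NB A → (i, j) ∈ A := by
    intro i j k1 l1 k2 l2 h h1 h2 h3 h4 h5
    exact hc (i, j) (mem_DF.2 (by omega)) _ h1 _ h2 (by simpa using h3) h4 h5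
  obtain ⟨p, q⟩ := d
  obtain ⟨u1, u2⟩ := u
  have hdn := mem_DF.1 (hA hd)
  rw [mem_DF] at hdT
  rw [mem_UF] at huT
  rw [mem_Nb'] at hu
  rcases hu with hu | hu | hu
  · -- hypotenuse
    have all := interval_prop (fun p' => (p', a + b + k - 1 - p') ∈ A) a (a + k - 1) p
      (by
        intro p' h1 h2 h3
        refine cl _ _ (p' + 1) (a + b + k - 1 - (p' + 1)) (p' + 1) (a + b + k - 1 - p')
          (by omega) (mem_Nb'.2 (by omega)) (mem_Nb'.2 (by omega)) (by omega)
          (hUN (mem_UF.2 (by omega))) (mem_NB_of h3 (by omega)))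
      (by
        intro p' h1 h2 h3
        refine cl _ _ p' (a + b + k - 1 - p') (p' + 1) (a + b + k - 1 - p')
          (by omega) (mem_Nb'.2 (by omega)) (mem_Nb'.2 (by omega)) (by omega)
          (hUN (mem_UF.2 (by omega))) (mem_NB_of h3 (by omega)))
      (by omega) (by omega)
      (by
        change (p, a + b + k - 1 - p) ∈ A
        rw [show a + b + k - 1 - p = q by omega]; exact hd)
    refine hmax a b (by omega) ?_ ?_
    · rintro ⟨i, j⟩ h; rw [mem_DF] at *; omega
    · rintro ⟨i, j⟩ h
      rw [mem_DF] at h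
      by_cases h2 : i + j + 2 ≤ a + b + k
      · exact hT (mem_DF.2 (by omega))
      · have := all i (by omega) (by omega)
        rwa [show a + b + k - 1 - i = j by omega] at this
  · -- left side
    have all := interval_prop (fun q' => (a - 1, q') ∈ A) b (b + k - 1) q
      (by
        intro q' h1 h2 h3
        refine cl _ _ (a - 1) (q' + 1) a (q' + 1)
          (by omega) (mem_Nb'.2 (by omega)) (mem_Nb'.2 (by omega)) (by omega)
          (mem_NB_of h3 (by omega)) (hUN (mem_UF.2 (by omega))))
      (by
        intro q' h1 h2 h3
        refine cl _ _ (a - 1) (q' + 1) a q'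
          (by omega) (mem_Nb'.2 (by omega)) (mem_Nb'.2 (by omega)) (by omega)
          (mem_NB_of h3 (by omega)) (hUN (mem_UF.2 (by omega))))
      (by omega) (by omega)
      (by
        change (a - 1, q) ∈ A
        rw [show a - 1 = p by omega]; exact hd)
    refine hmax (a - 1) b (by omega) ?_ ?_
    · rintro ⟨i, j⟩ h; rw [mem_DF] at *; omega
    · rintro ⟨i, j⟩ h
      rw [mem_DF] at h
      by_cases h2 : a ≤ i
      · exact hT (mem_DF.2 (by omega))
      · have := all j (by omega) (by omega)
        rwa [show a - 1 = i by omega] at this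
  · -- bottom side
    have all := interval_prop (fun p' => (p', b - 1) ∈ A) a (a + k - 1) p
      (by
        intro p' h1 h2 h3
        refine cl _ _ (p' + 1) (b - 1) (p' + 1) b
          (by omega) (mem_Nb'.2 (by omega)) (mem_Nb'.2 (by omega)) (by omega)
          (mem_NB_of h3 (by omega)) (hUN (mem_UF.2 (by omega))))
      (by
        intro p' h1 h2 h3
        refine cl _ _ (p' + 1) (b - 1) p' b
          (by omega) (mem_Nb'.2 (by omega)) (mem_Nb'.2 (by omega)) (by omega)
          (mem_NB_of h3 (by omega)) (hUN (mem_UF.2 (by omega))))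
      (by omega) (by omega)
      (by
        change (p, b - 1) ∈ A
        rw [show b - 1 = q by omega]; exact hd)
    refine hmax a (b - 1) (by omega) ?_ ?_
    · rintro ⟨i, j⟩ h; rw [mem_DF] at *; omega
    · rintro ⟨i, j⟩ h
      rw [mem_DF] at h
      by_cases h2 : b ≤ j
      · exact hT (mem_DF.2 (by omega))
      · have := all i (by omega) (by omega)
        rwa [show b - 1 = j by omega] at this

lemma tri_hall {n : ℕ} {S : Finset (ℕ × ℕ)} (hspread : SpreadOut n S) {a b k : ℕ}
    (h : a + b + k ≤ n) : (DF a b k).card ≤ (UF a b k \ S).card := by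
  have h1 := hspread a b k h
  have h2 : UF a b k ∩ S ⊆
      S.filter (fun p => a ≤ p.1 ∧ b ≤ p.2 ∧ p.1 + p.2 + 1 ≤ a + b + k) := by
    rintro ⟨i, j⟩ hu
    rw [Finset.mem_inter, mem_UF] at hu
    rw [Finset.mem_filter]
    exact ⟨hu.2, hu.1⟩
  have h3 := Finset.card_le_card h2
  have h4 := Finset.card_sdiff_add_card_inter (UF a b k) S
  have h5 := card_UF a b k
  omega

lemma closed_hall {n : ℕ} {S : Finset (ℕ × ℕ)} (hspread : SpreadOut n S) :
    ∀ c, ∀ A : Finset (ℕ × ℕ), A.card ≤ c → A ⊆ DF 0 0 n → ClosedD n A →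
      A.card ≤ (NB A \ S).card := by
  intro c
  induction c with
  | zero => intro A h _ _; omega
  | succ c ih =>
    intro A hcard hA hc
    rcases A.eq_empty_or_nonempty with rfl | ⟨⟨x, y⟩, hd0⟩
    · simp
    let P : ℕ → Prop := fun k => ∃ a b, a + b + k ≤ n ∧ DF a b k ⊆ A ∧ (x, y) ∈ DF a b k
    have hxy := mem_DF.1 (hA hd0)
    have hP2 : P 2 := by
      refine ⟨x, y, by omega, ?_, mem_DF.2 (by omega)⟩
      rintro ⟨i, j⟩ h
      rw [mem_DF] at h
      have h1 : i = x := by omega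
      have h2 : j = y := by omega
      rw [h1, h2]; exact hd0
    classical
    have hk2 : 2 ≤ Nat.findGreatest P n := Nat.le_findGreatest (by omega) hP2
    have hPk : P (Nat.findGreatest P n) := Nat.findGreatest_spec (m := 2) (by omega) hP2
    have hmaxk : ∀ k', Nat.findGreatest P n < k' → k' ≤ n → ¬ P k' :=
      fun k' h1 h2 => Nat.findGreatest_is_greatest h1 h2
    generalize Nat.findGreatest P n = k at hk2 hPk hmaxk
    obtain ⟨a, b, hn, hT, hxT⟩ := hPk
    have hdis := maximal_disjoint hA hc hk2 hn hT (by
      intro a' b' h1 h2 h3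
      exact hmaxk (k + 1) (by omega) (by omega) ⟨a', b', h1, h3, h2 hxT⟩)
    have hUN := UF_subset_NB hk2 hT
    have hsub : NB (A \ DF a b k) ⊆ NB A := by
      intro u hu
      obtain ⟨d, hd, hud⟩ := mem_NB.1 hu
      exact mem_NB.2 ⟨d, (Finset.mem_sdiff.1 hd).1, hud⟩
    have hdisj : ∀ u ∈ NB (A \ DF a b k), u ∉ UF a b k := by
      intro u hu
      obtain ⟨d, hd, hud⟩ := mem_NB.1 hu
      exact hdis d (Finset.mem_sdiff.1 hd).1 (Finset.mem_sdiff.1 hd).2 u hud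
    have hcard2 : (A \ DF a b k).card + (DF a b k).card = A.card := by
      rw [Finset.card_sdiff_add_card_eq_card hT]
    have hDpos : 0 < (DF a b k).card := Finset.card_pos.2 ⟨_, hxT⟩
    have h1 := ih (A \ DF a b k) (by omega) (Finset.sdiff_subset.trans hA) (by
      intro d hd u hu v hv huv hu2 hv2
      refine Finset.mem_sdiff.2 ⟨hc d hd u hu v hv huv (hsub hu2) (hsub hv2), ?_⟩
      intro hdT
      apply hdisj u hu2
      obtain ⟨p, q⟩ := d
      obtain ⟨u1, u2⟩ := u
      rw [mem_DF] at hdT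
      rw [mem_Nb'] at hu
      rw [mem_UF]
      omega)
    have h2 := tri_hall hspread hn
    have h3 : (NB (A \ DF a b k) \ S) ∪ (UF a b k \ S) ⊆ NB A \ S := by
      apply Finset.union_subset
      · exact Finset.sdiff_subset_sdiff hsub le_rfl
      · exact Finset.sdiff_subset_sdiff hUN le_rfl
    have h4 := Finset.card_le_card h3
    rw [Finset.card_union_of_disjoint] at h4
    · omega
    · rw [Finset.disjoint_left]
      intro u hu hu2
      exact hdisj u (Finset.mem_sdiff.1 hu).1 (Finset.mem_sdiff.1 hu2).1

lemma all_hall {n : ℕ} {S : Finset (ℕ × ℕ)} (hspread : SpreadOut n S) :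
    ∀ c, ∀ A : Finset (ℕ × ℕ), (DF 0 0 n).card ≤ A.card + c → A ⊆ DF 0 0 n →
      A.card ≤ (NB A \ S).card := by
  intro c
  induction c with
  | zero =>
    intro A h hA
    have hAe : A = DF 0 0 n := Finset.eq_of_subset_of_card_le hA (by omega)
    refine closed_hall hspread _ A le_rfl hA ?_
    intro d hd _ _ _ _ _ _ _
    rw [hAe]; exact hd
  | succ c ih =>
    intro A h hA
    by_cases hc : ClosedD n A
    · exact closed_hall hspread _ A le_rfl hA hc
    · unfold ClosedD at hc
      push Not at hc
      obtain ⟨d, hd, u, hu, v, hv, huv, hu2, hv2, hdA⟩ := hc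
      have h1 := ih (insert d A) (by rw [Finset.card_insert_of_notMem hdA]; omega)
        (Finset.insert_subset hd hA)
      rw [Finset.card_insert_of_notMem hdA] at h1
      have h2 : ∃ w, NB (insert d A) \ S ⊆ insert w (NB A \ S) := by
        have h3 : ∃ w, Nb d ⊆ {u, v, w} := by
          have h5 : (Nb d \ {u, v}).card ≤ 1 := by
            have h6 : ({u, v} : Finset (ℕ × ℕ)) ⊆ Nb d := by
              intro z hz
              simp only [Finset.mem_insert, Finset.mem_singleton] at hz
              rcases hz with rfl | rfl
              · exact hu
              · exact hv
            have h7 := Finset.card_sdiff_add_card_eq_card h6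
            rw [Finset.card_pair huv] at h7
            have h8 : (Nb d).card ≤ 3 := Finset.card_le_three
            omega
          obtain ⟨w, hw⟩ := Finset.card_le_one_iff_subset_singleton.1 h5
          refine ⟨w, ?_⟩
          intro z hz
          by_cases hz2 : z ∈ ({u, v} : Finset (ℕ × ℕ))
          · simp only [Finset.mem_insert, Finset.mem_singleton] at hz2 ⊢
            tauto
          · have := hw (Finset.mem_sdiff.2 ⟨hz, hz2⟩)
            simp only [Finset.mem_insert, Finset.mem_singleton] at this ⊢
            tauto
        obtain ⟨w, hw⟩ := h3
        refine ⟨w, ?_⟩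
        intro z hz
        obtain ⟨hz1, hz2⟩ := Finset.mem_sdiff.1 hz
        obtain ⟨e, he, hze⟩ := mem_NB.1 hz1
        rw [Finset.mem_insert]
        rcases Finset.mem_insert.1 he with rfl | he
        · have := hw hze
          simp only [Finset.mem_insert, Finset.mem_singleton] at this
          rcases this with rfl | rfl | rfl
          · right; exact Finset.mem_sdiff.2 ⟨hu2, hz2⟩
          · right; exact Finset.mem_sdiff.2 ⟨hv2, hz2⟩
          · left; rfl
        · right; exact Finset.mem_sdiff.2 ⟨mem_NB.2 ⟨e, he, hze⟩, hz2⟩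
      obtain ⟨w, hw⟩ := h2
      have h9 := Finset.card_le_card hw
      have h10 := Finset.card_insert_le w (NB A \ S)
      omega

lemma mem_DF_down {n : ℕ} {d : ℕ × ℕ} : d ∈ DF 0 0 n ↔ d ∈ DownTri n := by
  obtain ⟨i, j⟩ := d
  rw [mem_DF]
  simp only [DownTri, Set.mem_ofPred_eq]
  omega

lemma mem_UF_up {n : ℕ} {d : ℕ × ℕ} : d ∈ UF 0 0 n ↔ d ∈ UpTri n := by
  obtain ⟨i, j⟩ := d
  rw [mem_UF]
  simp only [UpTri, Set.mem_ofPred_eq]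
  omega

lemma exists_tiling (n : ℕ) (S : Finset (ℕ × ℕ)) (hS : ↑S ⊆ UpTri n) (hcard : S.card = n)
    (hspread : SpreadOut n S) : ∃ f, IsTiling n ↑S f := by
  classical
  let t : {d // d ∈ DF 0 0 n} → Finset (ℕ × ℕ) := fun d => Nb d.1 \ S
  obtain ⟨φ, hinj, hφ⟩ := (Finset.all_card_le_biUnion_card_iff_exists_injective t).1 (by
    intro s
    have h1 := all_hall hspread _ (s.map (Function.Embedding.subtype _)) (Nat.le_add_left _ _) (by
      intro d hd
      obtain ⟨e, _, rfl⟩ := Finset.mem_map.1 hd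
      exact e.2)
    rw [Finset.card_map] at h1
    refine h1.trans (Finset.card_le_card ?_)
    intro u hu
    obtain ⟨hu1, hu2⟩ := Finset.mem_sdiff.1 hu
    obtain ⟨d, hd, hud⟩ := mem_NB.1 hu1
    obtain ⟨e, he, rfl⟩ := Finset.mem_map.1 hd
    exact Finset.mem_biUnion.2 ⟨e, he, Finset.mem_sdiff.2 ⟨hud, hu2⟩⟩)
  let f : ℕ × ℕ → ℕ × ℕ := fun d => if h : d ∈ DF 0 0 n then φ ⟨d, h⟩ else d
  have hfv : ∀ d (h : d ∈ DF 0 0 n), f d = φ ⟨d, h⟩ := fun d h => dif_pos h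
  have hmem : ∀ d ∈ DF 0 0 n, f d ∈ Nb d ∧ f d ∉ S := by
    intro d h
    rw [hfv d h]
    exact Finset.mem_sdiff.1 (hφ ⟨d, h⟩)
  have hmaps : ∀ d ∈ DF 0 0 n, f d ∈ UF 0 0 n \ S := by
    intro d h
    refine Finset.mem_sdiff.2 ⟨?_, (hmem d h).2⟩
    have h1 := (hmem d h).1
    obtain ⟨i, j⟩ := d
    generalize f (i, j) = u at h1
    obtain ⟨u1, u2⟩ := u
    rw [mem_Nb'] at h1
    rw [mem_DF] at h
    rw [mem_UF]
    omega
  have hinjF : Set.InjOn f (DF 0 0 n) := by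
    intro d hd e he h
    rw [hfv d hd, hfv e he] at h
    simpa using hinj h
  have himg : (DF 0 0 n).image f = UF 0 0 n \ S := by
    apply Finset.eq_of_subset_of_card_le
    · intro u hu
      obtain ⟨d, hd, rfl⟩ := Finset.mem_image.1 hu
      exact hmaps d hd
    · rw [Finset.card_image_of_injOn hinjF]
      have h1 : S ⊆ UF 0 0 n := fun u hu => mem_UF_up.2 (hS hu)
      have h2 := Finset.card_sdiff_add_card_eq_card h1
      have h3 := card_UF 0 0 n
      omega
  refine ⟨f, ⟨?_, ?_, ?_⟩, ?_⟩
  · intro d hd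
    have := Finset.mem_sdiff.1 (hmaps d (mem_DF_down.2 hd))
    exact ⟨mem_UF_up.1 this.1, this.2⟩
  · intro d hd e he h
    exact hinjF (mem_DF_down.2 hd) (mem_DF_down.2 he) h
  · rintro u ⟨hu1, hu2⟩
    have : u ∈ (DF 0 0 n).image f := by
      rw [himg]
      exact Finset.mem_sdiff.2 ⟨mem_UF_up.2 hu1, hu2⟩
    obtain ⟨d, hd, rfl⟩ := Finset.mem_image.1 this
    exact ⟨d, mem_DF_down.1 hd, rfl⟩
  · intro d hd
    exact mem_Nb.1 (hmem d (mem_DF_down.2 hd)).1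

/-- Rotation along the ring. -/
def rotR (a b q : ℕ) (d : ℕ × ℕ) : ℕ × ℕ :=
  if d.1 = a ∧ b ≤ d.2 ∧ d.2 < b + q then (d.1, d.2 + 1)
  else if a ≤ d.1 ∧ d.1 < a + q ∧ d.1 + d.2 = a + b + q then (d.1 + 1, d.2 - 1)
  else if d.2 = b ∧ a < d.1 ∧ d.1 ≤ a + q then (d.1 - 1, d.2)
  else d

/-- Inverse rotation along the ring. -/
def rotS (a b q : ℕ) (d : ℕ × ℕ) : ℕ × ℕ :=
  if d.1 = a ∧ b < d.2 ∧ d.2 ≤ b + q then (d.1, d.2 - 1)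
  else if a < d.1 ∧ d.1 ≤ a + q ∧ d.1 + d.2 = a + b + q then (d.1 - 1, d.2 + 1)
  else if d.2 = b ∧ a ≤ d.1 ∧ d.1 < a + q then (d.1 + 1, d.2)
  else d

lemma rotS_rotR (a b q : ℕ) (d : ℕ × ℕ) : rotS a b q (rotR a b q d) = d := by
  obtain ⟨i, j⟩ := d
  unfold rotR
  split_ifs <;> unfold rotS <;> simp only at * <;> split_ifs <;>
    first | omega | (apply Prod.ext <;> (try simp only) <;> omega)

lemma rotR_rotS (a b q : ℕ) (d : ℕ × ℕ) : rotR a b q (rotS a b q d) = d := by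
  obtain ⟨i, j⟩ := d
  unfold rotS
  split_ifs <;> unfold rotR <;> simp only at * <;> split_ifs <;>
    first | omega | (apply Prod.ext <;> (try simp only) <;> omega)

lemma rotR_mem {n a b q : ℕ} (hn : a + b + (q + 2) ≤ n) {d : ℕ × ℕ} (hd : d ∈ DownTri n) :
    rotR a b q d ∈ DownTri n := by
  obtain ⟨i, j⟩ := d
  simp only [DownTri, Set.mem_ofPred_eq] at *
  unfold rotR
  split_ifs <;> simp only at * <;> omega

lemma rotS_mem {n a b q : ℕ} (hn : a + b + (q + 2) ≤ n) {d : ℕ × ℕ} (hd : d ∈ DownTri n) :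
    rotS a b q d ∈ DownTri n := by
  obtain ⟨i, j⟩ := d
  simp only [DownTri, Set.mem_ofPred_eq] at *
  unfold rotS
  split_ifs <;> simp only at * <;> omega

lemma rot_adj {n a b q : ℕ} {S : Set (ℕ × ℕ)} {f : ℕ × ℕ → ℕ × ℕ} (hf : IsTiling n S f)
    (hc : CWx f a b q) {d : ℕ × ℕ} (hd : d ∈ DownTri n) : Adj (rotR a b q d) (f d) := by
  obtain ⟨i, j⟩ := d
  unfold rotR
  split_ifs with h1 h2 h3
  · rw [hc.left h1]; left; rfl
  · rw [hc.hyp h2]; right; right; simp only at *; ext <;> simp only <;> omega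
  · rw [hc.bot h3]; right; left; simp only at *; ext <;> simp only; omega
  · exact hf.2 _ hd

/-- Weight of a tiling. -/
def wt (n : ℕ) (f : ℕ × ℕ → ℕ × ℕ) : ℤ := ∑ d ∈ DF 0 0 n, (d.1 : ℤ) * ((f d).2 : ℤ)

lemma flip_up {n a b q : ℕ} {S : Set (ℕ × ℕ)} {f : ℕ × ℕ → ℕ × ℕ} (hf : IsTiling n S f)
    (hq : 1 ≤ q) (hn : a + b + (q + 2) ≤ n) (hc : CWx f a b q) :
    ∃ g, IsTiling n S g ∧ wt n f < wt n g := by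
  refine ⟨fun d => f (rotS a b q d), ⟨?_, ?_⟩, ?_⟩
  · have : Set.BijOn (rotS a b q) (DownTri n) (DownTri n) :=
      Set.InvOn.bijOn (f' := rotR a b q) ⟨fun d _ => rotR_rotS a b q d, fun d _ => rotS_rotR a b q d⟩
        (fun d hd => rotS_mem hn hd) (fun d hd => rotR_mem hn hd)
    exact hf.1.comp this
  · intro d hd
    have := rot_adj hf hc (rotS_mem hn hd)
    rwa [rotR_rotS] at this
  · have reidx : ∀ F : ℕ × ℕ → ℤ, ∑ d ∈ DF 0 0 n, F d = ∑ d ∈ DF 0 0 n, F (rotR a b q d) := by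
      intro F
      refine Finset.sum_nbij' (rotS a b q) (rotR a b q) ?_ ?_ ?_ ?_ ?_
      · intro d hd; exact mem_DF_down.2 (rotS_mem hn (mem_DF_down.1 hd))
      · intro d hd; exact mem_DF_down.2 (rotR_mem hn (mem_DF_down.1 hd))
      · intro d _; exact rotR_rotS a b q d
      · intro d _; exact rotS_rotR a b q d
      · intro d _; rw [rotR_rotS]
    unfold wt
    rw [reidx (fun d => (d.1 : ℤ) * ((f (rotS a b q d)).2 : ℤ))]
    simp only [rotS_rotR]
    have h0 := reidx (fun d => (d.1 : ℤ))
    have key : ∑ d ∈ DF 0 0 n, (d.1 : ℤ) * (((f d).2 : ℤ) - b) <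
        ∑ d ∈ DF 0 0 n, ((rotR a b q d).1 : ℤ) * (((f d).2 : ℤ) - b) := by
      apply Finset.sum_lt_sum
      · rintro ⟨i, j⟩ _
        unfold rotR
        split_ifs with h1 h2 h3
        · exact le_rfl
        · rw [hc.hyp h2]
          simp only at *
          apply mul_le_mul_of_nonneg_right <;> omega
        · rw [hc.bot h3]
          simp only at *
          rw [h3.1]; simp
        · exact le_rfl
      · refine ⟨(a, b + q), mem_DF.2 (by omega), ?_⟩
        unfold rotR
        simp only
        rw [if_neg (by omega), if_pos (by omega), hc.hyp (by omega)]
        simp only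
        apply mul_lt_mul_of_pos_right <;> omega
    simp only [mul_sub, Finset.sum_sub_distrib, ← Finset.sum_mul] at key
    rw [← h0] at key
    linarith

lemma exists_no_cwgd (n : ℕ) (S : Set (ℕ × ℕ)) (h : ∃ f, IsTiling n S f) :
    ∃ f, IsTiling n S f ∧ ∀ a b m : ℕ, 3 ≤ m → a + b + m ≤ n → ¬ CWGD f a b m := by
  have hb : ∀ f, IsTiling n S f → wt n f ≤ ∑ d ∈ DF 0 0 n, (d.1 : ℤ) * (n : ℤ) := by
    intro f hf
    apply Finset.sum_le_sum
    intro d hd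
    have h1 : f d ∈ UpTri n := (hf.1.mapsTo (mem_DF_down.1 hd)).1
    simp only [UpTri, Set.mem_ofPred_eq] at h1
    apply mul_le_mul_of_nonneg_left <;> omega
  obtain ⟨w, ⟨f, hf, hw⟩, hmax⟩ := Int.exists_greatest_of_bdd
    (P := fun w => ∃ f, IsTiling n S f ∧ wt n f = w)
    ⟨_, by rintro z ⟨f, hf, rfl⟩; exact hb f hf⟩
    (by obtain ⟨f, hf⟩ := h; exact ⟨_, f, hf, rfl⟩)
  refine ⟨f, hf, ?_⟩
  intro a b m hm hn hc
  obtain ⟨q, rfl⟩ : ∃ q, m = q + 2 := ⟨m - 2, by omega⟩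
  have hsub : RingDown a b (q + 2) ⊆ DownTri n := by
    rintro ⟨i, j⟩ h
    rw [ringDown_iff _ _ _ _ _ (by omega)] at h
    simp only [DownTri, Set.mem_ofPred_eq]
    omega
  have hx := cwx_of_cwgd (by omega) (hf.1.injOn.mono hsub) (fun d hd => hf.2 d (hsub hd)) hc
  obtain ⟨g, hg, hlt⟩ := flip_up hf (by omega) hn hx
  have := hmax _ ⟨g, hg, rfl⟩
  omega

/-- For every spread-out set `S` of `n` upward unit triangles, there is
exactly one tiling of Δ with hole set `S` containing no CW-GD at any `(a,b,m)`. -/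
theorem unique_tiling_no_cwgd (n : ℕ) (hn : 0 < n) (S : Finset (ℕ × ℕ))
    (hS : ↑S ⊆ UpTri n) (hcard : S.card = n) (hspread : SpreadOut n S) :
    ∃ f : ℕ × ℕ → ℕ × ℕ, IsTiling n ↑S f ∧
      (∀ a b m : ℕ, 3 ≤ m → a + b + m ≤ n → ¬ CWGD f a b m) ∧
      ∀ g : ℕ × ℕ → ℕ × ℕ, IsTiling n ↑S g →
        (∀ a b m : ℕ, 3 ≤ m → a + b + m ≤ n → ¬ CWGD g a b m) →
        Set.EqOn g f (DownTri n) := by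

  obtain ⟨f, hf, hc⟩ := exists_no_cwgd n ↑S (exists_tiling n S hS hcard hspread)
  exact ⟨f, hf, hc, fun g hg hcg => eqOn_of_no_cwgd hf hg hc hcg⟩
end

section
/- There is exactly one tiling of Δ whose hole set is the bottom row {(i,0) : 0 ≤ i ≤ n−1}. -/
/-- Any tiling with bottom-row holes matches every downward triangle with the one above it. -/
theorem tiling_forced (n : ℕ) (f : ℕ × ℕ → ℕ × ℕ)
    (hf : IsTiling n {p : ℕ × ℕ | p.2 = 0 ∧ p.1 ≤ n - 1} f) :
    ∀ j i : ℕ, i + j + 2 ≤ n → f (i, j) = (i, j + 1) := by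
  obtain ⟨⟨hm, hinj, -⟩, hadj⟩ := hf
  intro j
  induction j with
  | zero =>
    intro i hi
    have hd : (i, 0) ∈ DownTri n := hi
    have h1 := (hm hd).2
    rcases hadj _ hd with h | h | h
    · exact absurd (by rw [h]; exact ⟨rfl, by show i ≤ n - 1; omega⟩) h1
    · exact absurd (by rw [h]; exact ⟨rfl, by show i + 1 ≤ n - 1; omega⟩) h1
    · exact h
  | succ j ih =>
    intro i hi
    have hd : (i, j + 1) ∈ DownTri n := hi
    have key : ∀ i', i' + j + 2 ≤ n → f (i, j + 1) ≠ (i', j + 1) := by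
      intro i' hi' h
      have h2 : (i', j) ∈ DownTri n := hi'
      have h3 := hinj hd h2 (h.trans (ih i' hi').symm)
      simp at h3
    rcases hadj _ hd with h | h | h
    · exact absurd h (key i (by omega))
    · exact absurd h (key (i + 1) (by omega))
    · exact h

/-- There is exactly one tiling of Δ whose hole set is the bottom row
`{(i,0) : 0 ≤ i ≤ n-1}`. -/
theorem unique_bottom_row_tiling (n : ℕ) (hn : 0 < n) :
    (∃ f : ℕ × ℕ → ℕ × ℕ, IsTiling n {p : ℕ × ℕ | p.2 = 0 ∧ p.1 ≤ n - 1} f) ∧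
      ∀ f g : ℕ × ℕ → ℕ × ℕ, IsTiling n {p : ℕ × ℕ | p.2 = 0 ∧ p.1 ≤ n - 1} f →
        IsTiling n {p : ℕ × ℕ | p.2 = 0 ∧ p.1 ≤ n - 1} g →
        Set.EqOn f g (DownTri n) := by
  constructor
  · refine ⟨fun p => (p.1, p.2 + 1), ⟨?_, ?_, ?_⟩, ?_⟩
    · rintro ⟨i, j⟩ h
      simp only [DownTri, UpTri, Set.mem_setOf_eq, Set.mem_diff] at h ⊢
      omega
    · rintro ⟨i, j⟩ _ ⟨i', j'⟩ _ h
      simpa using h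
    · rintro ⟨i, j⟩ h
      simp only [UpTri, Set.mem_setOf_eq, Set.mem_diff] at h
      refine ⟨(i, j - 1), ?_, ?_⟩
      · simp only [DownTri, Set.mem_setOf_eq]
        omega
      · simp only [Prod.mk.injEq, true_and]
        omega
    · intro d _
      exact Or.inr (Or.inr rfl)
  · rintro f g hf hg ⟨i, j⟩ h
    rw [tiling_forced n f hf j i h, tiling_forced n g hg j i h]
end

section
/- For any two tilings f and g of Δ (possibly with different hole sets), there exists a finite sequence of tilings f = f₀, f₁, …, f_m = g in which each f_{k+1} is obtained from f_k by a trapezoid flip, and 3m ≤ 2n(n−1); that is, any two fine mixed subdivisions of Δ are connected by at most 2n(n−1)/3 trapezoid flips. -/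
/-- `g` is obtained from the tiling `f` by a trapezoid flip: for some hole set `S` of `f`,
some hole `u ∈ S` and some downward unit triangle `d` adjacent to `u`, we have `g d = u`
and `g d' = f d'` for all `d' ≠ d`. -/
def TrapFlip (n : ℕ) (f g : ℕ × ℕ → ℕ × ℕ) : Prop :=
  ∃ (S : Set (ℕ × ℕ)) (u d : ℕ × ℕ), IsTiling n S f ∧ u ∈ S ∧ d ∈ DownTri n ∧ Adj d u ∧
    g d = u ∧ ∀ d', d' ≠ d → g d' = f d'

/-- Tilings without reference to a hole set. -/
def PreTiling (n : ℕ) (f : ℕ × ℕ → ℕ × ℕ) : Prop :=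
  Set.InjOn f (DownTri n) ∧ ∀ d ∈ DownTri n, Adj d (f d)

theorem adj_mem_up {n : ℕ} {d u : ℕ × ℕ} (hd : d ∈ DownTri n) (h : Adj d u) : u ∈ UpTri n := by
  simp only [DownTri, UpTri, Set.mem_ofPred_eq, Adj] at *
  rcases h with rfl | rfl | rfl <;> simp <;> omega

theorem PreTiling.isTiling {n : ℕ} {f : ℕ × ℕ → ℕ × ℕ} (h : PreTiling n f) :
    IsTiling n (UpTri n \ f '' DownTri n) f := by
  refine ⟨⟨?_, h.1, ?_⟩, h.2⟩
  · intro d hd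
    exact ⟨adj_mem_up hd (h.2 d hd), fun hh => hh.2 ⟨d, hd, rfl⟩⟩
  · rintro u ⟨hu, hh⟩
    by_contra hc
    exact hh ⟨hu, hc⟩

theorem trapFlip_of {n : ℕ} {f g : ℕ × ℕ → ℕ × ℕ} (h : PreTiling n f) {d u : ℕ × ℕ}
    (hd : d ∈ DownTri n) (hu : Adj d u) (hn : u ∉ f '' DownTri n) (hg : g d = u)
    (hg' : ∀ d', d' ≠ d → g d' = f d') : TrapFlip n f g :=
  ⟨_, u, d, h.isTiling, ⟨adj_mem_up hd hu, hn⟩, hd, hu, hg, hg'⟩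

theorem flip_both {n : ℕ} {f : ℕ × ℕ → ℕ × ℕ} (h : PreTiling n f) {d u : ℕ × ℕ}
    (hd : d ∈ DownTri n) (hu : Adj d u) (hn : u ∉ f '' DownTri n) :
    PreTiling n (Function.update f d u) ∧ TrapFlip n f (Function.update f d u) ∧
      TrapFlip n (Function.update f d u) f := by
  have hne : ∀ x ∈ DownTri n, f x ≠ u := fun x hx e => hn ⟨x, hx, e⟩
  have hP : PreTiling n (Function.update f d u) := by
    constructor
    · intro x hx y hy hxy
      by_cases h1 : x = d <;> by_cases h2 : y = d
      · rw [h1, h2]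
      · subst h1
        simp only [Function.update_self, Function.update_of_ne h2] at hxy
        exact absurd hxy.symm (hne y hy)
      · subst h2
        simp only [Function.update_self, Function.update_of_ne h1] at hxy
        exact absurd hxy (hne x hx)
      · simp only [Function.update_of_ne h1, Function.update_of_ne h2] at hxy
        exact h.1 hx hy hxy
    · intro x hx
      by_cases h1 : x = d
      · subst h1; simpa using hu
      · simpa [Function.update_of_ne h1] using h.2 x hx
  refine ⟨hP, trapFlip_of h hd hu hn (by simp) (fun d' h' => by simp [h']), ?_⟩
  refine trapFlip_of hP hd (h.2 d hd) ?_ rfl (fun d' h' => by simp [h'])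
  rintro ⟨x, hx, e⟩
  by_cases h1 : x = d
  · subst h1
    simp only [Function.update_self] at e
    exact hne x hx e.symm
  · simp only [Function.update_of_ne h1] at e
    exact h1 (h.1 hx hd e)

/-- The downward triangles as a finset. -/
def DownFin (n : ℕ) : Finset (ℕ × ℕ) :=
  (Finset.range n ×ˢ Finset.range n).filter (fun p => p.1 + p.2 + 2 ≤ n)

theorem mem_downFin {n : ℕ} {d : ℕ × ℕ} : d ∈ DownFin n ↔ d ∈ DownTri n := by
  simp only [DownFin, DownTri, Finset.mem_filter, Finset.mem_product, Finset.mem_range,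
    Set.mem_ofPred_eq]
  omega

theorem card_downFin (n : ℕ) : 2 * (DownFin (n + 1)).card ≤ (n + 1) * n := by
  induction n with
  | zero => simp [DownFin]
  | succ k ih =>
    have hs : DownFin (k + 1 + 1) ⊆ DownFin (k + 1) ∪ Finset.HasAntidiagonal.antidiagonal k := by
      intro d hd
      rw [mem_downFin] at hd
      rw [Finset.mem_union, mem_downFin, Finset.HasAntidiagonal.mem_antidiagonal]
      simp only [DownTri, Set.mem_ofPred_eq] at *
      omega
    have h1 := (Finset.card_le_card hs).trans (Finset.card_union_le _ _)
    rw [Finset.Nat.card_antidiagonal] at h1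
    nlinarith

/-- Number of downward triangles at which `f` differs from `c`. -/
def bad (n : ℕ) (c f : ℕ × ℕ → ℕ × ℕ) : ℕ := ∑ d ∈ DownFin n, if f d = c d then 0 else 1

open Classical in
/-- `c` on downward triangles and `f` elsewhere. -/
noncomputable def glue (n : ℕ) (c f : ℕ × ℕ → ℕ × ℕ) : ℕ × ℕ → ℕ × ℕ :=
  fun d => if d ∈ DownTri n then c d else f d

theorem path_to {n : ℕ} (c : ℕ × ℕ → ℕ × ℕ) (r : ℕ × ℕ → ℕ) (hc : ∀ d, Adj d (c d))
    (hr : ∀ d ∈ DownTri n, ∀ d' ∈ DownTri n, d' ≠ d → Adj d' (c d) → c d ≠ c d' ∧ r d' < r d) :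
    ∀ (k : ℕ) (f : ℕ × ℕ → ℕ × ℕ), PreTiling n f → bad n c f = k →
      ∃ F : ℕ → ℕ × ℕ → ℕ × ℕ, F 0 = f ∧ F k = glue n c f ∧
        ∀ i < k, TrapFlip n (F i) (F (i + 1)) ∧ TrapFlip n (F (i + 1)) (F i) := by
  intro k
  induction k with
  | zero =>
    intro f hf hb
    refine ⟨fun _ => f, rfl, ?_, by simp⟩
    funext d
    unfold glue
    split_ifs with hd
    · by_contra hne
      have := (Finset.sum_eq_zero_iff.mp hb) d (mem_downFin.2 hd)
      simp [hne] at this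
    · rfl
  | succ k ih =>
    intro f hf hb
    have hex : ((DownFin n).filter (fun d => f d ≠ c d)).Nonempty := by
      by_contra hem
      rw [Finset.not_nonempty_iff_eq_empty, Finset.filter_eq_empty_iff] at hem
      have : bad n c f = 0 := Finset.sum_eq_zero fun d hd => by simp [not_not.1 (hem hd)]
      omega
    obtain ⟨d, hd, hmin⟩ := Finset.exists_min_image _ r hex
    rw [Finset.mem_filter, mem_downFin] at hd
    obtain ⟨hd, hbad⟩ := hd
    have hn : c d ∉ f '' DownTri n := by
      rintro ⟨x, hx, e⟩
      have hxd : x ≠ d := by rintro rfl; exact hbad e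
      obtain ⟨h1, h2⟩ := hr d hd x hx hxd (e ▸ hf.2 x hx)
      have := hmin x (by
        rw [Finset.mem_filter, mem_downFin]
        exact ⟨hx, by rw [e]; exact h1⟩)
      omega
    obtain ⟨hP, hF1, hF2⟩ := flip_both hf hd (hc d) hn
    have hb' : bad n c (Function.update f d (c d)) = k := by
      have hm := mem_downFin.2 hd
      unfold bad at hb ⊢
      rw [← Finset.add_sum_erase _ _ hm] at hb ⊢
      have : ∑ x ∈ (DownFin n).erase d, (if Function.update f d (c d) x = c x then 0 else 1)
          = ∑ x ∈ (DownFin n).erase d, (if f x = c x then 0 else 1) :=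
        Finset.sum_congr rfl fun x hx => by
          rw [Function.update_of_ne (Finset.ne_of_mem_erase hx)]
      rw [this]
      simp only [hbad, if_false, Function.update_self, if_true] at hb ⊢
      omega
    obtain ⟨F, h0, hk, hF⟩ := ih _ hP hb'
    refine ⟨fun i => Nat.casesOn i f F, rfl, ?_, ?_⟩
    · show F k = _
      rw [hk]
      funext x
      unfold glue
      split_ifs with hx
      · rfl
      · rw [Function.update_of_ne]
        rintro rfl; exact hx hd
    · intro i hi
      cases i with
      | zero =>
        show TrapFlip n f (F 0) ∧ TrapFlip n (F 0) f
        rw [h0]; exact ⟨hF1, hF2⟩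
      | succ i => exact hF i (by omega)

theorem path_between {n : ℕ} (c : ℕ × ℕ → ℕ × ℕ) (r : ℕ × ℕ → ℕ) (hc : ∀ d, Adj d (c d))
    (hr : ∀ d ∈ DownTri n, ∀ d' ∈ DownTri n, d' ≠ d → Adj d' (c d) → c d ≠ c d' ∧ r d' < r d)
    (f g : ℕ × ℕ → ℕ × ℕ) (hf : PreTiling n f) (hg : PreTiling n g) :
    ∃ F : ℕ → ℕ × ℕ → ℕ × ℕ, F 0 = f ∧
      Set.EqOn (F (bad n c f + bad n c g)) g (DownTri n) ∧
      ∀ k < bad n c f + bad n c g, TrapFlip n (F k) (F (k + 1)) := by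
  have e : ∀ d ∈ DownTri n, glue n g f d = g d := fun d hd => by simp [glue, hd]
  have hg' : PreTiling n (glue n g f) := by
    constructor
    · intro x hx y hy hxy
      rw [e x hx, e y hy] at hxy
      exact hg.1 hx hy hxy
    · intro x hx
      rw [e x hx]; exact hg.2 x hx
  have hb : bad n c (glue n g f) = bad n c g :=
    Finset.sum_congr rfl fun x hx => by rw [e x (mem_downFin.1 hx)]
  obtain ⟨F, F0, Fa, hF⟩ := path_to c r hc hr _ f hf rfl
  obtain ⟨G, G0, Gb, hG⟩ := path_to c r hc hr _ _ hg' hb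
  have hgl : glue n c (glue n g f) = glue n c f := by
    funext d; unfold glue; split_ifs <;> rfl
  rw [hgl] at Gb
  generalize bad n c f = a at *
  generalize bad n c g = b at *
  have key : ∀ k, a ≤ k → (if k ≤ a then F k else G (a + b - k)) = G (a + b - k) := by
    intro k hk
    split_ifs with h
    · obtain rfl : k = a := by omega
      rw [Fa, ← Gb]; congr 1; omega
    · rfl
  refine ⟨fun k => if k ≤ a then F k else G (a + b - k), by simpa using F0, ?_, ?_⟩
  · intro x hx
    beta_reduce
    rw [key _ (by omega), Nat.sub_self, G0, e x hx]
  · intro k hk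
    beta_reduce
    by_cases h : k < a
    · rw [if_pos (by omega), if_pos (by omega)]
      exact (hF k h).1
    · rw [key _ (by omega), key _ (by omega)]
      have := (hG (a + b - (k + 1)) (by omega)).2
      rwa [show a + b - (k + 1) + 1 = a + b - k by omega] at this

theorem bad_sum (n : ℕ) (f : ℕ × ℕ → ℕ × ℕ) (hf : PreTiling n f) :
    bad n (fun d => d) f + bad n (fun d => (d.1 + 1, d.2)) f + bad n (fun d => (d.1, d.2 + 1)) f
      ≤ 2 * (DownFin n).card := by
  unfold bad
  rw [← Finset.sum_add_distrib, ← Finset.sum_add_distrib, mul_comm, ← smul_eq_mul]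
  refine Finset.sum_le_card_nsmul _ _ _ fun d hd => ?_
  have := hf.2 d (mem_downFin.1 hd)
  rcases this with h | h | h <;> simp only [h, if_true] <;> split_ifs <;> simp

/-- Any two fine mixed subdivisions of Δ (possibly with different hole
sets) are connected by a sequence of at most `2n(n-1)/3` trapezoid flips. -/
theorem trapezoid_flip_upper_bound (n : ℕ) (hn : 0 < n)
    (Sf Sg : Set (ℕ × ℕ)) (f g : ℕ × ℕ → ℕ × ℕ)
    (hf : IsTiling n Sf f) (hg : IsTiling n Sg g) :
    ∃ (m : ℕ) (F : ℕ → ℕ × ℕ → ℕ × ℕ),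
      F 0 = f ∧ Set.EqOn (F m) g (DownTri n) ∧
      (∀ k < m, TrapFlip n (F k) (F (k + 1))) ∧
      3 * m ≤ 2 * n * (n - 1) := by
  have hf' : PreTiling n f := ⟨hf.1.injOn, hf.2⟩
  have hg' : PreTiling n g := ⟨hg.1.injOn, hg.2⟩
  have sf := bad_sum n f hf'
  have sg := bad_sum n g hg'
  have hcard : 2 * (DownFin n).card ≤ n * (n - 1) := by
    obtain ⟨k, rfl⟩ : ∃ k, n = k + 1 := ⟨n - 1, by omega⟩
    simpa using card_downFin k
  have hA := path_between (n := n) (fun d => d) (fun d => d.1 + d.2) (fun d => Or.inl rfl)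
    (by
      rintro ⟨a, b⟩ hd ⟨a', b'⟩ hd' hne hadj
      simp only [Adj, DownTri, Set.mem_ofPred_eq, ne_eq, Prod.mk.injEq] at *
      omega) f g hf' hg'
  have hB := path_between (n := n) (fun d => (d.1 + 1, d.2)) (fun d => n - d.1)
    (fun d => Or.inr (Or.inl rfl))
    (by
      rintro ⟨a, b⟩ hd ⟨a', b'⟩ hd' hne hadj
      simp only [Adj, DownTri, Set.mem_ofPred_eq, ne_eq, Prod.mk.injEq] at *
      omega) f g hf' hg'
  have hC := path_between (n := n) (fun d => (d.1, d.2 + 1)) (fun d => n - d.2)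
    (fun d => Or.inr (Or.inr rfl))
    (by
      rintro ⟨a, b⟩ hd ⟨a', b'⟩ hd' hne hadj
      simp only [Adj, DownTri, Set.mem_ofPred_eq, ne_eq, Prod.mk.injEq] at *
      omega) f g hf' hg'
  rw [mul_assoc]
  generalize n * (n - 1) = N at *
  rcases (by omega : 3 * (bad n (fun d => d) f + bad n (fun d => d) g) ≤ 2 * N ∨
      3 * (bad n (fun d => (d.1 + 1, d.2)) f + bad n (fun d => (d.1 + 1, d.2)) g) ≤ 2 * N ∨
      3 * (bad n (fun d => (d.1, d.2 + 1)) f + bad n (fun d => (d.1, d.2 + 1)) g) ≤ 2 * N)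
    with h | h | h
  · obtain ⟨F, h0, h1, h2⟩ := hA
    exact ⟨_, F, h0, h1, h2, h⟩
  · obtain ⟨F, h0, h1, h2⟩ := hB
    exact ⟨_, F, h0, h1, h2, h⟩
  · obtain ⟨F, h0, h1, h2⟩ := hC
    exact ⟨_, F, h0, h1, h2, h⟩
end

section
/- Let f and g be tilings of Δ that share no rhombus, i.e., f(d) ≠ g(d) for every downward unit triangle d. Then every sequence f = f₀, f₁, …, f_m = g of tilings in which each f_{k+1} is obtained from f_k by a trapezoid flip has length m ≥ n(n−1)/2. -/
/-- After `k` flips, the map differs from the initial one in at most `k` places. -/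
theorem flip_diff_card (n m : ℕ) (F : ℕ → ℕ × ℕ → ℕ × ℕ)
    (hstep : ∀ k < m, TrapFlip n (F k) (F (k + 1))) :
    ∀ k ≤ m, ∃ T : Finset (ℕ × ℕ), T.card ≤ k ∧ ∀ d, d ∉ T → F k d = F 0 d := by
  intro k
  induction k with
  | zero => exact fun _ => ⟨∅, by simp, fun _ _ => rfl⟩
  | succ k ih =>
    intro hk
    obtain ⟨T, hT, hTd⟩ := ih (by omega)
    obtain ⟨S, u, d, -, -, -, -, -, h⟩ := hstep k (by omega)
    refine ⟨insert d T, (Finset.card_insert_le _ _).trans (by omega), fun d' hd' => ?_⟩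
    rw [Finset.mem_insert, not_or] at hd'
    rw [h d' hd'.1, hTd d' hd'.2]

/-- A finite set containing all downward triangles has at least `n(n-1)/2` elements. -/
theorem downTri_card (n : ℕ) (T : Finset (ℕ × ℕ)) (hT : ∀ d ∈ DownTri n, d ∈ T) :
    n * (n - 1) ≤ 2 * T.card := by
  have hsub : (Finset.range (n - 1)).biUnion (fun s => Finset.HasAntidiagonal.antidiagonal s) ⊆ T := by
    intro d hd
    simp only [Finset.mem_biUnion, Finset.mem_range, Finset.HasAntidiagonal.mem_antidiagonal] at hd
    obtain ⟨s, hs, hd⟩ := hd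
    apply hT
    simp only [DownTri, Set.mem_ofPred_eq]
    omega
  have hc := Finset.card_le_card hsub
  rw [Finset.card_biUnion] at hc
  · simp only [Finset.Nat.card_antidiagonal] at hc
    have key : ∀ N : ℕ, 2 * ∑ s ∈ Finset.range N, (s + 1) = (N + 1) * N := by
      intro N
      induction N with
      | zero => simp
      | succ N ih => rw [Finset.sum_range_succ, mul_add, ih]; ring
    rcases n with _ | N
    · simp
    · have := key N
      simp only [Nat.add_sub_cancel] at hc ⊢
      omega
  · intro a _ b _ hab
    rw [Function.onFun_apply, Finset.disjoint_left]
    intro d h1 h2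
    rw [Finset.HasAntidiagonal.mem_antidiagonal] at h1 h2
    omega

/-- If the tilings `f` and `g` share no rhombus (`f d ≠ g d` for every
downward unit triangle `d`), then every sequence of trapezoid flips transforming `f`
into `g` has length at least `n(n-1)/2`. -/
theorem trapezoid_flip_disjoint_lower_bound (n : ℕ) (hn : 0 < n)
    (Sf Sg : Set (ℕ × ℕ)) (f g : ℕ × ℕ → ℕ × ℕ)
    (hf : IsTiling n Sf f) (hg : IsTiling n Sg g)
    (hdisj : ∀ d ∈ DownTri n, f d ≠ g d)
    (m : ℕ) (F : ℕ → ℕ × ℕ → ℕ × ℕ)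
    (h0 : F 0 = f) (hm : Set.EqOn (F m) g (DownTri n))
    (hstep : ∀ k < m, TrapFlip n (F k) (F (k + 1))) :
    n * (n - 1) ≤ 2 * m := by
  obtain ⟨T, hT, hTd⟩ := flip_diff_card n m F hstep m le_rfl
  have := downTri_card n T (fun d hd => by
    by_contra hdT
    apply hdisj d hd
    rw [← hm hd, hTd d hdT, h0])
  omega
end
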